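/- arXiv:1402.4248 — 4 statements merged into one kernel-verified Lean document; each statement's English description precedes it below -/
import Mathlib

section
/- Let F:ℝⁿ⇉ℝⁿ satisfy (SH) and let K be a convex compact subset of ℝⁿ. Then hypothesis (H2) holds with constant c' on K if and only if F(x) is R-convex for all x ∈ K with radius R = (2c')⁻¹. Moreover, if (H2) holds, then ∇ₚH(x,p) exists for all x ∈ K and p ∈ ℝⁿ∖{0}, and is Hölder continuous in x on K with exponent 1/2, uniformly for p in any compact subset of ℝⁿ∖{0}. -/
open MeasureTheory Filter Metric Set Topology
open scoped RealInnerProductSpace ENNReal NNReal Pointwise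

noncomputable section

variable {E : Type*} [NormedAddCommGroup E] [InnerProductSpace ℝ E] [CompleteSpace E]

/-- The Hamiltonian `H(x,p) = sup_{v ∈ F x} ⟪v,p⟫` associated with `F`. -/
def Ham (F : E → Set E) (x p : E) : ℝ :=
  sSup ((fun v => ⟪v, p⟫) '' F x)

/-- Standing hypotheses (SH): nonempty convex compact values, local Lipschitz continuity
with respect to the Hausdorff metric, and sublinear growth. -/
def StandingHyp (F : E → Set E) : Prop :=
  (∀ x, (F x).Nonempty ∧ Convex ℝ (F x) ∧ IsCompact (F x)) ∧
  (∀ x : E, ∃ ε > (0:ℝ), ∃ c : ℝ, 0 ≤ c ∧ ∀ y ∈ ball x ε, ∀ z ∈ ball x ε,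
    EMetric.hausdorffEdist (F y) (F z) ≤ ENNReal.ofReal (c * dist y z)) ∧
  (∃ r > (0:ℝ), ∀ x : E, ∀ v ∈ F x, ‖v‖ ≤ r * (1 + ‖x‖))

/-- `f` is semiconvex on `K` with constant `c`. -/
def SemiconvexWith (f : E → ℝ) (K : Set E) (c : ℝ) : Prop :=
  ∀ x h : E, x + h ∈ K → x - h ∈ K → -(c * ‖h‖ ^ 2) ≤ f (x + h) + f (x - h) - 2 * f x

/-- `f` is semiconcave on `K` with constant `c`. -/
def SemiconcaveWith (f : E → ℝ) (K : Set E) (c : ℝ) : Prop :=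
  ∀ x h : E, x + h ∈ K → x - h ∈ K → f (x + h) + f (x - h) - 2 * f x ≤ c * ‖h‖ ^ 2

def LocSemiconcave (f : E → ℝ) : Prop :=
  ∀ x : E, ∃ ε > (0:ℝ), ∃ c : ℝ, SemiconcaveWith f (ball x ε) c

def LocSemiconvex (f : E → ℝ) : Prop :=
  ∀ x : E, ∃ ε > (0:ℝ), ∃ c : ℝ, SemiconvexWith f (ball x ε) c

open scoped Classical in
/-- The gradient `∇ₚH(x,p)` of `H(x,·)` at `p` (junk value `0` if it does not exist). -/
def gradpH (F : E → Set E) (x p : E) : E :=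
  if h : ∃ g, HasGradientAt (fun q => Ham F x q) g p then h.choose else 0

/-- Hypothesis (H1): semiconvexity of `H(·,p)` with constant `c‖p‖` on compact convex sets,
existence of `∇ₚH(x,p)` for `p ≠ 0`, and local Lipschitz continuity of `x ↦ ∇ₚH(x,p)`,
uniformly for `p` in compact subsets of `ℝⁿ ∖ {0}`. -/
def HypH1 (F : E → Set E) : Prop :=
  (∀ K : Set E, K.Nonempty → Convex ℝ K → IsCompact K →
    ∃ c : ℝ, 0 ≤ c ∧ ∀ p : E, SemiconvexWith (fun x => Ham F x p) K (c * ‖p‖)) ∧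
  (∀ x p : E, p ≠ 0 → HasGradientAt (fun q => Ham F x q) (gradpH F x p) p) ∧
  (∀ K : Set E, K.Nonempty → Convex ℝ K → IsCompact K →
    ∀ P : Set E, IsCompact P → (0:E) ∉ P →
      ∃ L : ℝ≥0, ∀ p ∈ P, LipschitzOnWith L (fun x => gradpH F x p) K)

/-- Fréchet subdifferential `∂⁻f(x)`. -/
def FSub (f : E → ℝ) (x : E) : Set E :=
  {p | ∀ ε > (0:ℝ), ∀ᶠ y in 𝓝 x, -(ε * ‖y - x‖) ≤ f y - f x - ⟪p, y - x⟫}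

/-- Fréchet superdifferential `∂⁺f(x)`. -/
def FSuper (f : E → ℝ) (x : E) : Set E :=
  {p | ∀ ε > (0:ℝ), ∀ᶠ y in 𝓝 x, f y - f x - ⟪p, y - x⟫ ≤ ε * ‖y - x‖}

/-- Proximal superdifferential `∂^{+,pr}f(x)`. -/
def ProxSuper (f : E → ℝ) (x : E) : Set E :=
  {p | ∃ c : ℝ, 0 ≤ c ∧ ∃ ρ > (0:ℝ), ∀ y ∈ closedBall x ρ,
    f y - f x - ⟪p, y - x⟫ ≤ c * ‖y - x‖ ^ 2}

/-- Clarke's generalized gradient of `f` at `x`: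
`ζ ∈ ∂f(x)` iff `⟪ζ,v⟫ ≤ limsup_{y→x, h→0⁺} (f(y+hv)-f(y))/h` for all `v`. -/
def ClarkeGrad (f : E → ℝ) (x : E) : Set E :=
  {ζ | ∀ v : E, ∀ ε > (0:ℝ),
    ∃ᶠ q : E × ℝ in (𝓝 x) ×ˢ (𝓝[>] (0:ℝ)),
      ⟪ζ, v⟫ - ε ≤ (f (q.1 + q.2 • v) - f q.1) / q.2}

/-- `x` is absolutely continuous on `[t0,T]` with (a.e.) derivative `x'`. -/
def ACArc (t0 T : ℝ) (x x' : ℝ → E) : Prop :=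
  IntervalIntegrable x' volume t0 T ∧
  (∀ s ∈ Icc t0 T, x s = x t0 + ∫ r in t0..s, x' r) ∧
  (∀ᵐ s ∂volume, s ∈ Icc t0 T → HasDerivAt x (x' s) s)

/-- `x` is a trajectory of the differential inclusion `x' ∈ F(x)` on `[t0,T]`. -/
def IsTraj (F : E → Set E) (t0 T : ℝ) (x x' : ℝ → E) : Prop :=
  ACArc t0 T x x' ∧ ∀ᵐ s ∂volume, s ∈ Icc t0 T → x' s ∈ F (x s)

/-- `x` is an optimal trajectory for the Mayer problem `P(t0,x0)`. -/
def IsOptimal (F : E → Set E) (φ : E → ℝ) (t0 T : ℝ) (x0 : E) (x x' : ℝ → E) : Prop :=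
  IsTraj F t0 T x x' ∧ x t0 = x0 ∧
  ∀ y y' : ℝ → E, IsTraj F t0 T y y' → y t0 = x0 → φ (x T) ≤ φ (y T)

/-- The value function of the Mayer problem. -/
def valueFn (F : E → Set E) (φ : E → ℝ) (T t : ℝ) (x : E) : ℝ :=
  sInf {r | ∃ y y' : ℝ → E, IsTraj F t T y y' ∧ y t = x ∧ r = φ (y T)}

/-- Fréchet superdifferential of `W` in the pair `(t,x)`. -/
def FSuperPair (W : ℝ → E → ℝ) (t : ℝ) (x : E) : Set (ℝ × E) :=
  {q | ∀ ε > (0:ℝ), ∀ᶠ sy : ℝ × E in 𝓝 (t, x),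
    W sy.1 sy.2 - W t x - q.1 * (sy.1 - t) - ⟪q.2, sy.2 - x⟫ ≤
      ε * ‖((sy.1 - t, sy.2 - x) : ℝ × E)‖}

/-- Fréchet subdifferential of `W` in the pair `(t,x)`. -/
def FSubPair (W : ℝ → E → ℝ) (t : ℝ) (x : E) : Set (ℝ × E) :=
  {q | ∀ ε > (0:ℝ), ∀ᶠ sy : ℝ × E in 𝓝 (t, x),
    -(ε * ‖((sy.1 - t, sy.2 - x) : ℝ × E)‖) ≤
      W sy.1 sy.2 - W t x - q.1 * (sy.1 - t) - ⟪q.2, sy.2 - x⟫}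

/-- Proximal superdifferential of `W` in the pair `(t,x)`. -/
def ProxSuperPair (W : ℝ → E → ℝ) (t : ℝ) (x : E) : Set (ℝ × E) :=
  {q | ∃ c : ℝ, 0 ≤ c ∧ ∃ ρ > (0:ℝ), ∀ s : ℝ, ∀ y : E,
    dist ((s, y) : ℝ × E) ((t, x) : ℝ × E) ≤ ρ →
      W s y - W t x - q.1 * (s - t) - ⟪q.2, y - x⟫ ≤ c * ‖((s - t, y - x) : ℝ × E)‖ ^ 2}

/-- `V` is differentiable at `(t,x)` with (pair) gradient `q = (∂ₜV, ∇ₓV)`. -/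
def HasGradPair (W : ℝ → E → ℝ) (t : ℝ) (x : E) (q : ℝ × E) : Prop :=
  HasFDerivAt (fun sy : ℝ × E => W sy.1 sy.2)
    (q.1 • ContinuousLinearMap.fst ℝ ℝ E +
      (innerSL ℝ q.2).comp (ContinuousLinearMap.snd ℝ ℝ E)) (t, x)

/-- The reachable (limiting) gradient `∂*W(t,x)`. -/
def ReachGradPair (W : ℝ → E → ℝ) (t : ℝ) (x : E) : Set (ℝ × E) :=
  {q | ∃ u g : ℕ → ℝ × E,
    (∀ i, HasGradPair W (u i).1 (u i).2 (g i)) ∧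
    Tendsto u atTop (𝓝 (t, x)) ∧ Tendsto g atTop (𝓝 q)}

/-- Normal cone (of convex analysis) to `A` at `z`. -/
def normalConeAt (A : Set E) (z : E) : Set E :=
  {p | ∀ v ∈ A, ⟪p, v - z⟫ ≤ 0}

/-- `A` is `R`-convex. -/
def RConvex (A : Set E) (R : ℝ) : Prop :=
  ∀ z ∈ frontier A, ∀ y ∈ frontier A, ∀ n ∈ normalConeAt A z, ∀ m ∈ normalConeAt A y,
    ‖n‖ = 1 → ‖m‖ = 1 → ‖z - y‖ ≤ R * ‖n - m‖

/-- `F` is locally strongly convex. -/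
def LocStronglyConvex (F : E → Set E) : Prop :=
  ∀ K : Set E, IsCompact K → ∃ R > (0:ℝ), ∀ x ∈ K, RConvex (F x) R

/-- `ℝⁿ` as a Euclidean space. -/
abbrev Euc (n : ℕ) : Type := EuclideanSpace ℝ (Fin n)


/-- Hypothesis (H2) with constant `c'` on `K`: for all `x ∈ K`, `p`, and every maximizer
`v_p` of `⟪·,p⟫` over `F(x)`, one has `⟪v−v_p,p⟫ ≤ −c'|p||v−v_p|²` for all `v ∈ F(x)`. -/
def HypH2On (F : E → Set E) (K : Set E) (c' : ℝ) : Prop :=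
  ∀ x ∈ K, ∀ p : E, ∀ vp ∈ F x, (∀ v ∈ F x, ⟪v, p⟫ ≤ ⟪vp, p⟫) →
    ∀ v ∈ F x, ⟪v - vp, p⟫ ≤ -(c' * ‖p‖ * ‖v - vp‖ ^ 2)

variable {V : Type*} [NormedAddCommGroup V] [InnerProductSpace ℝ V]

/-- The single-set form of (H2). -/
def StronglyMaximizing (A : Set E) (c : ℝ) : Prop :=
  ∀ p : E, ∀ vp ∈ A, (∀ v ∈ A, ⟪v, p⟫ ≤ ⟪vp, p⟫) →
    ∀ v ∈ A, ⟪v - vp, p⟫ ≤ -(c * ‖p‖ * ‖v - vp‖ ^ 2)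

theorem IsCompact.exists_forall_inner_le {A : Set V} (hA : IsCompact A) (hne : A.Nonempty)
    (p : V) : ∃ v ∈ A, ∀ w ∈ A, ⟪w, p⟫ ≤ ⟪v, p⟫ := by
  obtain ⟨v, hv, hmax⟩ := hA.exists_isMaxOn hne
    (f := fun v : V => ⟪v, p⟫) (by fun_prop)
  exact ⟨v, hv, fun w hw => hmax hw⟩

theorem mem_normalConeAt_iff {A : Set V} {z p : V} :
    p ∈ normalConeAt A z ↔ ∀ v ∈ A, ⟪v, p⟫ ≤ ⟪z, p⟫ := by
  simp only [normalConeAt, mem_ofPred_eq, inner_sub_right, sub_nonpos, real_inner_comm]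

theorem mem_frontier_of_mem_normalConeAt {A : Set V} {z p : V} (hz : z ∈ A) (hp : p ≠ 0)
    (h : p ∈ normalConeAt A z) : z ∈ frontier A := by
  refine ⟨subset_closure hz, fun hint => ?_⟩
  have hlim : Tendsto (fun t : ℝ => z + t • p) (𝓝[>] 0) (𝓝 z) := by
    have : Tendsto (fun t : ℝ => z + t • p) (𝓝 0) (𝓝 (z + (0 : ℝ) • p)) :=
      Continuous.tendsto (by fun_prop) 0
    simpa using this.mono_left nhdsWithin_le_nhds
  obtain ⟨t, ht, ht0⟩ :=
    ((hlim.eventually (mem_interior_iff_mem_nhds.1 hint)).and self_mem_nhdsWithin).exists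
  have h1 := h _ ht
  rw [add_sub_cancel_left, inner_smul_right, real_inner_self_eq_norm_sq] at h1
  have : 0 < t * ‖p‖ ^ 2 := mul_pos ht0 (by positivity)
  linarith

theorem StronglyMaximizing.rConvex {A : Set V} (hA : IsClosed A) {c : ℝ} (hc : 0 < c)
    (h : StronglyMaximizing A c) : RConvex A (2 * c)⁻¹ := by
  intro z hz y hy n hn m hm hn1 hm1
  have hzA := hA.frontier_subset hz
  have hyA := hA.frontier_subset hy
  have h1 := h n z hzA (mem_normalConeAt_iff.1 hn) y hyA
  have h2 := h m y hyA (mem_normalConeAt_iff.1 hm) z hzA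
  rw [hn1, norm_sub_rev] at h1
  rw [hm1] at h2
  have h3 : ⟪z - y, n - m⟫ = -⟪y - z, n⟫ - ⟪z - y, m⟫ := by
    simp only [inner_sub_left, inner_sub_right]; ring
  have h4 := real_inner_le_norm (z - y) (n - m)
  rw [inv_mul_eq_div, le_div_iff₀ (by positivity)]
  rcases (norm_nonneg (z - y)).eq_or_lt with h0 | h0
  · rw [← h0]; simp
  · refine le_of_mul_le_mul_left ?_ h0
    nlinarith

theorem norm_sq_circle_sub {n e : V} (hn : ‖n‖ = 1) (he : ‖e‖ = 1) (hne : ⟪n, e⟫ = 0)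
    (s t : ℝ) :
    ‖(Real.cos t • n + Real.sin t • e) - (Real.cos s • n + Real.sin s • e)‖ ^ 2 ≤ (t - s) ^ 2 := by
  have h1 : (Real.cos t • n + Real.sin t • e) - (Real.cos s • n + Real.sin s • e)
      = (Real.cos t - Real.cos s) • n + (Real.sin t - Real.sin s) • e := by module
  have h2 := Real.one_sub_sq_div_two_le_cos (x := t - s)
  rw [h1, norm_add_sq_real, inner_smul_left, inner_smul_right, hne, norm_smul, norm_smul, hn, he,
    Real.norm_eq_abs, Real.norm_eq_abs, mul_one, mul_one, sq_abs, sq_abs]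
  rw [Real.cos_sub] at h2
  simp only [mul_zero, add_zero]
  nlinarith [Real.sin_sq_add_cos_sq s, Real.sin_sq_add_cos_sq t]

theorem norm_circle_sub_le {n e : V} (hn : ‖n‖ = 1) (he : ‖e‖ = 1) (hne : ⟪n, e⟫ = 0)
    (s t : ℝ) :
    ‖(Real.cos t • n + Real.sin t • e) - (Real.cos s • n + Real.sin s • e)‖ ≤ |t - s| :=
  abs_le_of_sq_le_sq' (by rw [sq_abs]; exact norm_sq_circle_sub hn he hne s t) (abs_nonneg _) |>.2

theorem norm_circle {n e : V} (hn : ‖n‖ = 1) (he : ‖e‖ = 1) (hne : ⟪n, e⟫ = 0)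
    (s : ℝ) : ‖Real.cos s • n + Real.sin s • e‖ = 1 := by
  have : ‖Real.cos s • n + Real.sin s • e‖ ^ 2 = 1 := by
    rw [norm_add_sq_real, inner_smul_left, inner_smul_right, hne, norm_smul, norm_smul, hn, he,
      Real.norm_eq_abs, Real.norm_eq_abs, mul_one, mul_one, sq_abs, sq_abs]
    simp
  exact (pow_eq_one_iff_of_nonneg (norm_nonneg _) two_ne_zero).1 this

/-- Along a great circle, maximizers over an `R`-convex set move no faster than over a ball of
radius `R`. -/
theorem RConvex.inner_circle_le {A : Set V} {R : ℝ} (hR : 0 ≤ R) (h : RConvex A R)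
    {v : V → V} (hvA : ∀ p, v p ∈ A) (hv : ∀ p, ∀ w ∈ A, ⟪w, p⟫ ≤ ⟪v p, p⟫)
    {n e : V} (hn : ‖n‖ = 1) (he : ‖e‖ = 1) (hne : ⟪n, e⟫ = 0)
    {θ : ℝ} (hθ : θ ∈ Icc 0 Real.pi) :
    ⟪v (Real.cos θ • n + Real.sin θ • e) - v n, Real.cos θ • n + Real.sin θ • e⟫
      ≤ R * (1 - Real.cos θ) := by
  set μ : ℝ → V := fun s => Real.cos s • n + Real.sin s • e with hμ
  have hμ1 : ∀ s, ‖μ s‖ = 1 := norm_circle hn he hne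
  have hμL : ∀ s t, ‖μ t - μ s‖ ≤ |t - s| := norm_circle_sub_le hn he hne
  have hfr : ∀ p : V, ‖p‖ = 1 → v p ∈ frontier A := fun p hp =>
    mem_frontier_of_mem_normalConeAt (hvA p) (by rintro rfl; simp at hp)
      (mem_normalConeAt_iff.2 (hv p))
  have hvL : ∀ s t, ‖v (μ t) - v (μ s)‖ ≤ R * |t - s| := fun s t =>
    (h _ (hfr _ (hμ1 t)) _ (hfr _ (hμ1 s)) _ (mem_normalConeAt_iff.2 (hv _)) _
      (mem_normalConeAt_iff.2 (hv _)) (hμ1 t) (hμ1 s)).trans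
      (mul_le_mul_of_nonneg_left (hμL s t) hR)
  have hcont : Continuous fun s => v (μ s) :=
    (LipschitzWith.of_dist_le_mul (K := ⟨R, hR⟩) fun t s => by
      rw [dist_eq_norm, Real.dist_eq]; exact hvL s t).continuous
  have hderiv : ∀ s, HasDerivAt (fun s => ⟪v n, μ θ⟫ + R * (Real.cos (θ - s) - Real.cos θ))
      (R * Real.sin (θ - s)) s := by
    intro s
    have h1 : HasDerivAt (fun s => θ - s) (-1) s := by
      simpa using (hasDerivAt_id s).const_sub θ
    exact (((h1.cos.sub_const (Real.cos θ)).const_mul R).const_add ⟪v n, μ θ⟫).congr_deriv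
      (by ring)
  have key := image_le_of_liminf_slope_right_le_deriv_boundary (a := 0) (b := θ)
    (f := fun s => ⟪v (μ s), μ θ⟫)
    (B := fun s => ⟪v n, μ θ⟫ + R * (Real.cos (θ - s) - Real.cos θ))
    (B' := fun s => R * Real.sin (θ - s))
    (hcont.inner continuous_const).continuousOn (by simp [hμ]) (by fun_prop)
    (fun s _ => (hderiv s).hasDerivWithinAt)
    (by
      intro s hs r hr
      apply Eventually.frequently
      have hlim : Tendsto (fun t => R * Real.sin (θ - s) + R * (t - s)) (𝓝[>] s)
          (𝓝 (R * Real.sin (θ - s))) := by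
        have : Tendsto (fun t => R * Real.sin (θ - s) + R * (t - s)) (𝓝 s)
          (𝓝 (R * Real.sin (θ - s) + R * (s - s))) := Continuous.tendsto (by fun_prop) s
        simpa using this.mono_left nhdsWithin_le_nhds
      filter_upwards [hlim.eventually (gt_mem_nhds hr), self_mem_nhdsWithin] with t ht hst
      refine lt_of_le_of_lt ?_ ht
      have hst : 0 < t - s := sub_pos.2 hst
      have hdec : μ θ =
          Real.cos (θ - s) • μ s + Real.sin (θ - s) • (-Real.sin s • n + Real.cos s • e) := by
        have e1 : Real.cos θ = Real.cos (θ - s) * Real.cos s - Real.sin (θ - s) * Real.sin s := by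
          rw [← Real.cos_add]; ring_nf
        have e2 : Real.sin θ = Real.sin (θ - s) * Real.cos s + Real.cos (θ - s) * Real.sin s := by
          rw [← Real.sin_add]; ring_nf
        simp only [hμ]
        rw [e1, e2]
        module
      have hd := hvL s t
      rw [abs_of_pos hst] at hd
      have hm := hμL s t
      rw [abs_of_pos hst] at hm
      have h1 : ⟪v (μ t) - v (μ s), μ s⟫ ≤ 0 := by
        rw [inner_sub_left]; linarith [hv (μ s) _ (hvA (μ t))]
      have h2 : -(R * (t - s) * (t - s)) ≤ ⟪v (μ t) - v (μ s), μ s⟫ := by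
        have h3 : 0 ≤ ⟪v (μ t) - v (μ s), μ t⟫ := by
          rw [inner_sub_left]; linarith [hv (μ t) _ (hvA (μ s))]
        have h4 : ⟪v (μ t) - v (μ s), μ t - μ s⟫ ≤ R * (t - s) * (t - s) :=
          (real_inner_le_norm _ _).trans
            (mul_le_mul hd hm (norm_nonneg _) (by positivity))
        rw [inner_sub_right] at h4
        linarith
      have h5 : ⟪v (μ t) - v (μ s), -Real.sin s • n + Real.cos s • e⟫ ≤ R * (t - s) := by
        refine (real_inner_le_norm _ _).trans ?_
        have : ‖-Real.sin s • n + Real.cos s • e‖ = 1 := by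
          have := norm_circle hn he hne (s + Real.pi / 2)
          rwa [Real.cos_add_pi_div_two, Real.sin_add_pi_div_two] at this
        rw [this, mul_one]
        exact hd
      have h6 : 0 ≤ Real.sin (θ - s) :=
        Real.sin_nonneg_of_nonneg_of_le_pi (by linarith [hs.2]) (by linarith [hs.1, hθ.2])
      have h7 : Real.cos (θ - s) * ⟪v (μ t) - v (μ s), μ s⟫ ≤ R * (t - s) * (t - s) := by
        nlinarith [Real.neg_one_le_cos (θ - s)]
      have h8 := mul_le_mul_of_nonneg_left h5 h6
      rw [slope_def_field, div_le_iff₀ hst, ← inner_sub_left, hdec, inner_add_right,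
        inner_smul_right, inner_smul_right]
      nlinarith)
    (right_mem_Icc.2 hθ.1)
  simp only [sub_self, Real.cos_zero] at key
  rw [inner_sub_left]
  linarith

theorem RConvex.inner_sub_le {A : Set V} {R : ℝ} (hR : 0 ≤ R) (h : RConvex A R)
    (hA : IsCompact A) {z w n m : V} (hz : z ∈ A) (hw : w ∈ A) (hn : ‖n‖ = 1) (hm : ‖m‖ = 1)
    (hzn : ∀ v ∈ A, ⟪v, n⟫ ≤ ⟪z, n⟫) : ⟪w - z, m⟫ ≤ R * (1 - ⟪n, m⟫) := by
  choose v hvA hv using hA.exists_forall_inner_le ⟨z, hz⟩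
  have hne0 : ∀ p : V, ‖p‖ = 1 → p ≠ 0 := by rintro p hp rfl; simp at hp
  have hzv : z = v n := by
    have := h z (mem_frontier_of_mem_normalConeAt hz (hne0 n hn) (mem_normalConeAt_iff.2 hzn))
      (v n) (mem_frontier_of_mem_normalConeAt (hvA n) (hne0 n hn) (mem_normalConeAt_iff.2 (hv n)))
      n (mem_normalConeAt_iff.2 hzn) n (mem_normalConeAt_iff.2 (hv n)) hn hn
    rw [sub_self, norm_zero, mul_zero] at this
    exact sub_eq_zero.1 (norm_le_zero_iff.1 this)
  have hwm : ⟪w - z, m⟫ ≤ ⟪v m - z, m⟫ := by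
    simp only [inner_sub_left]; linarith [hv m w hw]
  refine hwm.trans ?_
  have hle := real_inner_le_norm n m
  have hge := neg_le_of_abs_le (abs_real_inner_le_norm n m)
  rw [hn, hm, mul_one] at hle hge
  rcases eq_or_ne m n with rfl | hmn
  · rw [real_inner_self_eq_norm_sq, hm, hzv]; simp
  rcases eq_or_ne m (-n) with hmn' | hmn'
  · have h1 := h (v m)
      (mem_frontier_of_mem_normalConeAt (hvA m) (hne0 m hm) (mem_normalConeAt_iff.2 (hv m)))
      z (mem_frontier_of_mem_normalConeAt hz (hne0 n hn) (mem_normalConeAt_iff.2 hzn))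
      m (mem_normalConeAt_iff.2 (hv m)) n (mem_normalConeAt_iff.2 hzn) hm hn
    have h2 := real_inner_le_norm (v m - z) m
    have h3 : ‖m - n‖ = 2 := by
      rw [hmn', show -n - n = (-2 : ℝ) • n by module, norm_smul, hn]; norm_num
    have h4 : ⟪n, m⟫ = -1 := by
      rw [hmn', inner_neg_right, real_inner_self_eq_norm_sq, hn]; norm_num
    rw [hm, mul_one] at h2
    rw [h3] at h1
    rw [h4]
    linarith
  · set c := ⟪n, m⟫ with hc
    have hc1 : c ≠ 1 := fun h1 => hmn ((inner_eq_one_iff_of_norm_eq_one hn hm).1 h1).symm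
    have hc2 : c ≠ -1 := fun h1 => hmn' <| by
      have : ⟪n, -m⟫ = 1 := by rw [inner_neg_right, ← hc, h1]; norm_num
      rw [(inner_eq_one_iff_of_norm_eq_one hn (by rwa [norm_neg])).1 this, neg_neg]
    have hcl : c < 1 := lt_of_le_of_ne hle hc1
    have hcg : -1 < c := lt_of_le_of_ne hge hc2.symm
    have hs : 0 < Real.sin (Real.arccos c) := by
      rw [Real.sin_arccos]; exact Real.sqrt_pos.2 (by nlinarith)
    have hcos : Real.cos (Real.arccos c) = c := Real.cos_arccos hge hle
    set s := Real.sin (Real.arccos c) with hsdef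
    have hsc : s ^ 2 = 1 - c ^ 2 := by
      rw [hsdef, Real.sin_sq, hcos]
    have hnorm : ‖m - c • n‖ = s := by
      have : ‖m - c • n‖ ^ 2 = s ^ 2 := by
        rw [norm_sub_sq_real, inner_smul_right, real_inner_comm, ← hc, norm_smul, hn, hm, hsc,
          mul_one, Real.norm_eq_abs, sq_abs]
        ring
      exact (sq_eq_sq₀ (norm_nonneg _) hs.le).1 this
    have hm_eq : m =
        Real.cos (Real.arccos c) • n + Real.sin (Real.arccos c) • (s⁻¹ • (m - c • n)) := by
      rw [hcos, ← hsdef, smul_smul, mul_inv_cancel₀ hs.ne', one_smul]; abel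
    have key := h.inner_circle_le hR hvA hv (n := n) (e := s⁻¹ • (m - c • n)) hn
      (by rw [norm_smul, hnorm, norm_inv, Real.norm_of_nonneg hs.le, inv_mul_cancel₀ hs.ne'])
      (by rw [inner_smul_right, inner_sub_right, inner_smul_right, real_inner_self_eq_norm_sq,
            hn, ← hc]; ring)
      (θ := Real.arccos c) ⟨Real.arccos_nonneg c, Real.arccos_le_pi c⟩
    rw [← hm_eq, hcos, ← hzv] at key
    exact key

theorem RConvex.stronglyMaximizing {A : Set V} (hA : IsCompact A) {c : ℝ} (hc : 0 < c)
    (h : RConvex A (2 * c)⁻¹) : StronglyMaximizing A c := by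
  intro p z hz hmax v hv
  rcases eq_or_ne p 0 with rfl | hp
  · simp
  set R := (2 * c)⁻¹ with hRdef
  have hR : 0 < R := by positivity
  have hp0 : 0 < ‖p‖ := norm_pos_iff.2 hp
  obtain ⟨n, hn⟩ : ∃ n : V, n = ‖p‖⁻¹ • p := ⟨_, rfl⟩
  have hn1 : ‖n‖ = 1 := by rw [hn, norm_smul, norm_inv, norm_norm, inv_mul_cancel₀ hp0.ne']
  have hpn : p = ‖p‖ • n := by rw [hn, smul_smul, mul_inv_cancel₀ hp0.ne', one_smul]
  have hmaxn : ∀ w ∈ A, ⟪w, n⟫ ≤ ⟪z, n⟫ := fun w hw => by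
    rw [hn, inner_smul_right, inner_smul_right]
    exact mul_le_mul_of_nonneg_left (hmax w hw) (by positivity)
  have hball : ‖v - z + R • n‖ ≤ R := by
    set u := v - z + R • n with hu
    rcases eq_or_ne u 0 with h0 | h0
    · rw [h0, norm_zero]; exact hR.le
    have hu0 : 0 < ‖u‖ := norm_pos_iff.2 h0
    have h1 := h.inner_sub_le hR.le hA hz hv hn1 (m := ‖u‖⁻¹ • u)
      (by rw [norm_smul, norm_inv, norm_norm, inv_mul_cancel₀ hu0.ne']) hmaxn
    have h2 : ⟪u, ‖u‖⁻¹ • u⟫ = ‖u‖ := by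
      rw [inner_smul_right, real_inner_self_eq_norm_sq]; field_simp
    have h3 : ⟪u, ‖u‖⁻¹ • u⟫ = ⟪v - z, ‖u‖⁻¹ • u⟫ + R * ⟪n, ‖u‖⁻¹ • u⟫ := by
      conv_lhs => rw [hu, inner_add_left, real_inner_smul_left, ← hu]
    linarith
  have hsq : ‖v - z + R • n‖ ^ 2 ≤ R ^ 2 := pow_le_pow_left₀ (norm_nonneg _) hball 2
  rw [norm_add_sq_real, inner_smul_right, norm_smul, hn1, mul_one, Real.norm_eq_abs, sq_abs]
    at hsq
  have hRc : 2 * c * R = 1 := mul_inv_cancel₀ (by positivity)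
  have h1 : ⟪v - z, n⟫ ≤ -(c * ‖v - z‖ ^ 2) := by
    have := mul_le_mul_of_nonneg_left hsq hc.le
    nlinarith
  have h2 : ⟪v - z, p⟫ = ‖p‖ * ⟪v - z, n⟫ := by
    conv_lhs => rw [hpn, inner_smul_right]
  rw [h2]
  have := mul_le_mul_of_nonneg_left h1 hp0.le
  linarith

theorem Ham_eq_inner {F : V → Set V} {x p v : V} (hv : v ∈ F x)
    (hmax : ∀ w ∈ F x, ⟪w, p⟫ ≤ ⟪v, p⟫) : Ham F x p = ⟪v, p⟫ :=
  IsGreatest.csSup_eq ⟨⟨v, hv, rfl⟩, by rintro _ ⟨w, hw, rfl⟩; exact hmax w hw⟩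

theorem StronglyMaximizing.hasGradientAt_Ham {F : E → Set E} {x p v : E} {c : ℝ} (hc : 0 < c)
    (h : StronglyMaximizing (F x) c) (hA : IsCompact (F x)) (hp : p ≠ 0) (hv : v ∈ F x)
    (hmax : ∀ w ∈ F x, ⟪w, p⟫ ≤ ⟪v, p⟫) : HasGradientAt (fun q => Ham F x q) v p := by
  have hp0 : 0 < ‖p‖ := norm_pos_iff.2 hp
  have hcp : 0 < c * ‖p‖ := by positivity
  rw [hasGradientAt_iff_isLittleO]
  refine Asymptotics.IsBigO.trans_isLittleO (g := fun q => ‖q - p‖ ^ 2) ?_ ?_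
  · refine Asymptotics.IsBigO.of_bound (c * ‖p‖)⁻¹ (Eventually.of_forall fun q => ?_)
    obtain ⟨u, hu, humax⟩ := hA.exists_forall_inner_le ⟨v, hv⟩ q
    rw [Ham_eq_inner hv hmax, Ham_eq_inner hu humax]
    have h1 : ⟪u, q⟫ - ⟪v, p⟫ - ⟪v, q - p⟫ = ⟪u - v, q⟫ := by
      simp only [inner_sub_left, inner_sub_right]; ring
    have h2 : 0 ≤ ⟪u - v, q⟫ := by rw [inner_sub_left]; linarith [humax v hv]
    have h3 := h p v hv hmax u hu
    have h4 : ⟪u - v, q - p⟫ = ⟪u - v, q⟫ - ⟪u - v, p⟫ := inner_sub_right _ _ _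
    have h5 := real_inner_le_norm (u - v) (q - p)
    rw [h1, Real.norm_of_nonneg h2, norm_pow, norm_norm, inv_mul_eq_div, le_div_iff₀ hcp]
    nlinarith [sq_nonneg (c * ‖p‖ * ‖u - v‖ - ‖q - p‖), sq_nonneg (c * ‖p‖ * ‖u - v‖)]
  · have := (Asymptotics.isLittleO_norm_pow_id (E' := E) one_lt_two)
    exact this.comp_tendsto (k := fun q => q - p)
      (tendsto_sub_nhds_zero_iff.2 tendsto_id)

theorem gradpH_eq {F : E → Set E} {x p v : E} (h : HasGradientAt (fun q => Ham F x q) v p) :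
    gradpH F x p = v := by
  have hex : ∃ g, HasGradientAt (fun q => Ham F x q) g p := ⟨v, h⟩
  rw [gradpH, dif_pos hex]
  exact hex.choose_spec.unique h

theorem exists_norm_sub_le_of_hausdorffEDist_le {X : Type*} [SeminormedAddCommGroup X]
    {A B : Set X} (hB : IsCompact B) {a : X}
    (ha : a ∈ A) (hne : B.Nonempty) {d : ℝ} (hd : 0 ≤ d)
    (h : hausdorffEDist A B ≤ ENNReal.ofReal d) : ∃ b ∈ B, ‖a - b‖ ≤ d := by
  obtain ⟨b, hb, hab⟩ := hB.exists_infEDist_eq_edist hne a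
  refine ⟨b, hb, ?_⟩
  have := (hab ▸ infEDist_le_hausdorffEDist_of_mem ha).trans h
  rwa [edist_dist, ENNReal.ofReal_le_ofReal_iff hd, dist_eq_norm] at this

theorem StronglyMaximizing.norm_sub_le {A B : Set V} {c d : ℝ} (hc : 0 < c) (hd : 0 ≤ d)
    (hA : IsCompact A) (hB : IsCompact B) (hS : StronglyMaximizing A c)
    (h : hausdorffEDist A B ≤ ENNReal.ofReal d) {p v w : V} (hp : p ≠ 0)
    (hv : v ∈ A) (hvmax : ∀ u ∈ A, ⟪u, p⟫ ≤ ⟪v, p⟫)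
    (hw : w ∈ B) (hwmax : ∀ u ∈ B, ⟪u, p⟫ ≤ ⟪w, p⟫) :
    ‖v - w‖ ≤ d + √(2 * d / c) := by
  have hp0 : 0 < ‖p‖ := norm_pos_iff.2 hp
  obtain ⟨w', hw', hww'⟩ := exists_norm_sub_le_of_hausdorffEDist_le hA hw ⟨v, hv⟩ hd
    (hausdorffEDist_comm (s := A) ▸ h)
  obtain ⟨v', hv', hvv'⟩ := exists_norm_sub_le_of_hausdorffEDist_le hB hv ⟨w, hw⟩ hd h
  have h1 := hS p v hv hvmax w' hw'
  have h2 := hwmax v' hv'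
  have h3 := (real_inner_le_norm (v - v') p).trans
    (mul_le_mul_of_nonneg_right hvv' (norm_nonneg p))
  have h4 := (real_inner_le_norm (w - w') p).trans
    (mul_le_mul_of_nonneg_right hww' (norm_nonneg p))
  rw [inner_sub_left] at h1 h3 h4
  have h5 : c * ‖w' - v‖ ^ 2 ≤ 2 * d := le_of_mul_le_mul_left (by nlinarith) hp0
  have h6 : ‖w' - v‖ ≤ √(2 * d / c) := by
    apply Real.le_sqrt_of_sq_le
    rw [le_div_iff₀ hc]; linarith
  have h7 : ‖v - w‖ ≤ ‖w' - v‖ + ‖w - w'‖ := by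
    rw [← norm_neg (v - w), show -(v - w) = (w' - v) + (w - w') by abel]
    exact norm_add_le _ _
  linarith

/-- Maximizers over `F x` are `1/2`-Hölder in `x` on a compact set where (H2) holds. -/
theorem StandingHyp.exists_holder_maximizers {F : V → Set V} (hF : StandingHyp F) {K : Set V}
    (hK : IsCompact K) {c : ℝ} (hc : 0 < c) (hS : HypH2On F K c) :
    ∃ C : ℝ, ∀ z ∈ K ×ˢ K, ∀ p ≠ 0, ∀ v ∈ F z.1, (∀ u ∈ F z.1, ⟪u, p⟫ ≤ ⟪v, p⟫) →
      ∀ w ∈ F z.2, (∀ u ∈ F z.2, ⟪u, p⟫ ≤ ⟪w, p⟫) → ‖v - w‖ ≤ C * √‖z.1 - z.2‖ := by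
  obtain ⟨hval, hlip, r, hr, hgrowth⟩ := hF
  refine (hK.prod hK).induction_on (p := fun S : Set (V × V) => ∃ C : ℝ, ∀ z ∈ S, ∀ p ≠ 0,
      ∀ v ∈ F z.1, (∀ u ∈ F z.1, ⟪u, p⟫ ≤ ⟪v, p⟫) →
      ∀ w ∈ F z.2, (∀ u ∈ F z.2, ⟪u, p⟫ ≤ ⟪w, p⟫) → ‖v - w‖ ≤ C * √‖z.1 - z.2‖)
    ⟨0, by simp⟩ ?_ ?_ ?_
  · rintro S T hST ⟨C, hC⟩
    exact ⟨C, fun z hz => hC z (hST hz)⟩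
  · rintro S T ⟨C, hC⟩ ⟨D, hD⟩
    refine ⟨max C D, ?_⟩
    rintro z (hz | hz) p hp v hv hvm w hw hwm
    · exact (hC z hz p hp v hv hvm w hw hwm).trans
        (mul_le_mul_of_nonneg_right (le_max_left _ _) (Real.sqrt_nonneg _))
    · exact (hD z hz p hp v hv hvm w hw hwm).trans
        (mul_le_mul_of_nonneg_right (le_max_right _ _) (Real.sqrt_nonneg _))
  · rintro ⟨x₀, y₀⟩ -
    rcases eq_or_ne x₀ y₀ with rfl | hne
    · obtain ⟨ε, hε, L, hL, hlip⟩ := hlip x₀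
      refine ⟨(K ×ˢ K) ∩ (ball x₀ ε ×ˢ ball x₀ ε),
        inter_mem_nhdsWithin _ (prod_mem_nhds (ball_mem_nhds _ hε) (ball_mem_nhds _ hε)),
        L * √(2 * ε) + √(2 * L / c), ?_⟩
      rintro ⟨x, y⟩ ⟨⟨hxK, -⟩, hx, hy⟩ p hp v hv hvm w hw hwm
      have hxy : ‖x - y‖ ≤ 2 * ε := by
        rw [← dist_eq_norm]
        linarith [dist_triangle_right x y x₀, mem_ball.1 hx, mem_ball.1 hy]
      have h1 := hlip x hx y hy
      rw [dist_eq_norm] at h1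
      have h2 := StronglyMaximizing.norm_sub_le hc (by positivity) (hval x).2.2 (hval y).2.2
        (hS x hxK) h1 hp hv hvm hw hwm
      have h3 : ‖x - y‖ ≤ √(2 * ε) * √‖x - y‖ := by
        conv_lhs => rw [← Real.mul_self_sqrt (norm_nonneg (x - y))]
        exact mul_le_mul_of_nonneg_right (Real.sqrt_le_sqrt hxy) (Real.sqrt_nonneg _)
      have h4 : √(2 * (L * ‖x - y‖) / c) = √(2 * L / c) * √‖x - y‖ := by
        rw [← Real.sqrt_mul (by positivity)]; congr 1; ring
      rw [h4] at h2
      have h5 := mul_le_mul_of_nonneg_left h3 hL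
      simp only
      linarith
    · set δ := ‖x₀ - y₀‖ with hδ
      have hδ0 : 0 < δ := norm_pos_iff.2 (sub_ne_zero.2 hne)
      have hopen : {z : V × V | δ / 2 < ‖z.1 - z.2‖} ∈ 𝓝 (x₀, y₀) :=
        (isOpen_lt continuous_const (by fun_prop)).mem_nhds (by simp only [mem_ofPred_eq]; linarith)
      obtain ⟨M, hM⟩ := hK.isBounded.exists_norm_le
      refine ⟨_, inter_mem_nhdsWithin (K ×ˢ K) hopen, 2 * (r * (1 + M)) / √(δ / 2), ?_⟩
      rintro ⟨x, y⟩ ⟨⟨hxK, hyK⟩, hxy⟩ p hp v hv hvm w hw hwm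
      have hvb : ‖v‖ ≤ r * (1 + M) := (hgrowth x v hv).trans (by gcongr; exact hM x hxK)
      have hwb : ‖w‖ ≤ r * (1 + M) := (hgrowth y w hw).trans (by gcongr; exact hM y hyK)
      have hs : 0 < √(δ / 2) := Real.sqrt_pos.2 (by positivity)
      have hs' : √(δ / 2) ≤ √‖x - y‖ := Real.sqrt_le_sqrt (le_of_lt hxy)
      have h0 : 0 ≤ 2 * (r * (1 + M)) := by linarith [norm_nonneg v]
      calc ‖v - w‖ ≤ 2 * (r * (1 + M)) := by linarith [_root_.norm_sub_le v w]
        _ = 2 * (r * (1 + M)) / √(δ / 2) * √(δ / 2) := by field_simp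
        _ ≤ 2 * (r * (1 + M)) / √(δ / 2) * √‖x - y‖ :=
          mul_le_mul_of_nonneg_left hs' (by positivity)

/-- Lemma 2.11.
Under (SH), for a convex compact `K`: (H2) holds with constant `c'` on `K` iff `F(x)` is
`R`-convex for all `x ∈ K` with `R = (2c')⁻¹`; moreover, if (H2) holds then `∇ₚH(x,p)`
exists for all `x ∈ K`, `p ≠ 0`, and is `1/2`-Hölder in `x` on `K`, uniformly for `p` in
compact subsets of `ℝⁿ∖{0}`. -/
theorem stmt14 {n : ℕ} (F : Euc n → Set (Euc n))
    (hSH : StandingHyp F) (K : Set (Euc n)) (hKc : Convex ℝ K) (hK : IsCompact K)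
    (c' : ℝ) (hc' : 0 < c') :
    (HypH2On F K c' ↔ ∀ x ∈ K, RConvex (F x) ((2 * c')⁻¹)) ∧
    (HypH2On F K c' →
      (∀ x ∈ K, ∀ p : Euc n, p ≠ 0 →
        HasGradientAt (fun q => Ham F x q) (gradpH F x p) p) ∧
      (∀ P : Set (Euc n), IsCompact P → (0 : Euc n) ∉ P →
        ∃ C : ℝ, ∀ p ∈ P, ∀ x ∈ K, ∀ y ∈ K,
          ‖gradpH F x p - gradpH F y p‖ ≤ C * Real.sqrt ‖x - y‖)) := by
  refine ⟨⟨fun h x hx => StronglyMaximizing.rConvex (hSH.1 x).2.2.isClosed hc' (h x hx),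
    fun h x hx => RConvex.stronglyMaximizing (hSH.1 x).2.2 hc' (h x hx)⟩, fun h => ?_⟩
  choose v hvF hv using fun x => (hSH.1 x).2.2.exists_forall_inner_le (hSH.1 x).1
  have hgrad : ∀ x ∈ K, ∀ p : Euc n, p ≠ 0 → HasGradientAt (fun q => Ham F x q) (v x p) p :=
    fun x hx p hp => StronglyMaximizing.hasGradientAt_Ham hc' (h x hx) (hSH.1 x).2.2 hp
      (hvF x p) (hv x p)
  refine ⟨fun x hx p hp => ?_, fun P _ hP => ?_⟩
  · rw [gradpH_eq (hgrad x hx p hp)]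
    exact hgrad x hx p hp
  · obtain ⟨C, hC⟩ := hSH.exists_holder_maximizers hK hc' h
    refine ⟨C, fun p hp x hx y hy => ?_⟩
    have hp0 : p ≠ 0 := fun h0 => hP (h0 ▸ hp)
    rw [gradpH_eq (hgrad x hx p hp0), gradpH_eq (hgrad y hy p hp0)]
    exact hC (x, y) ⟨hx, hy⟩ p hp0 _ (hvF x p) (hv x p) _ (hvF y p) (hv y p)

end
end

section
/- Assume (SH) and let φ:ℝⁿ→ℝ be locally Lipschitz. Then the value function V of the Mayer problem is locally Lipschitz on [0,T]×ℝⁿ and is the unique viscosity solution of the Hamilton–Jacobi equation −∂ₜu(t,x) + H(x, −uₓ(t,x)) = 0 in (0,T)×ℝⁿ with terminal condition u(T,x) = φ(x) for x ∈ ℝⁿ. -/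
open MeasureTheory Filter Metric Set Topology
open scoped RealInnerProductSpace ENNReal NNReal Pointwise

noncomputable section

variable {E : Type*} [NormedAddCommGroup E] [InnerProductSpace ℝ E] [CompleteSpace E]

/-- `u` is a viscosity solution of `−∂ₜu + H(x,−uₓ) = 0` on `(0,T)×ℝⁿ` with terminal
condition `u(T,·) = φ`. -/
def IsViscositySolution (F : E → Set E) (φ : E → ℝ) (T : ℝ) (u : ℝ → E → ℝ) : Prop :=
  (∀ x : E, u T x = φ x) ∧
  ∀ t ∈ Ioo (0:ℝ) T, ∀ x : E,
    (∀ q ∈ FSuperPair u t x, -q.1 + Ham F x (-q.2) ≤ 0) ∧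
    (∀ q ∈ FSubPair u t x, 0 ≤ -q.1 + Ham F x (-q.2))

section Auxiliary

set_option linter.unusedSectionVars false

/-- A set-valued map with nonempty closed convex values, uniformly bounded by `M` and globally
`c`-Lipschitz for the Hausdorff distance. -/
structure TameMap (G : E → Set E) (c M : ℝ) : Prop where
  pos : 0 < c
  nonneg : 0 ≤ M
  nonempty : ∀ x, (G x).Nonempty
  convex : ∀ x, Convex ℝ (G x)
  closed : ∀ x, IsClosed (G x)
  bdd : ∀ x, ∀ v ∈ G x, ‖v‖ ≤ M
  lip : ∀ x y, ∀ v ∈ G x, ∃ w ∈ G y, ‖v - w‖ ≤ c * ‖x - y‖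

theorem TameMap.exists_proj {G : E → Set E} {c M : ℝ} (hG : TameMap G c M) :
    ∃ P : E → E → E, Continuous (fun q : E × E => P q.1 q.2) ∧
      (∀ x v, P x v ∈ G x) ∧ ∀ x v, ∀ w ∈ G x, ‖v - P x v‖ ≤ ‖v - w‖ := by
  have h1 : ∀ x v, ∃ p ∈ G x, ‖v - p‖ = ⨅ w : G x, ‖v - w‖ := fun x v =>
    exists_norm_eq_iInf_of_complete_convex (hG.nonempty x) (hG.closed x).isComplete
      (hG.convex x) v
  choose P hPmem hPeq using h1
  have hin : ∀ x v, ∀ w ∈ G x, ⟪v - P x v, w - P x v⟫ ≤ 0 := fun x v =>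
    (norm_eq_iInf_iff_real_inner_le_zero (hG.convex x) (hPmem x v)).1 (hPeq x v)
  refine ⟨P, ?_, hPmem, ?_⟩
  · have key : ∀ x v x' v', ‖P x' v' - P x v‖ ^ 2 ≤
        ‖v' - v‖ * (2 * M) + c * ‖x' - x‖ * (‖v‖ + ‖v'‖ + 2 * M) := by
      intro x v x' v'
      set p := P x v
      set p' := P x' v'
      have hp : ‖p‖ ≤ M := hG.bdd x p (hPmem x v)
      have hp' : ‖p'‖ ≤ M := hG.bdd x' p' (hPmem x' v')
      obtain ⟨a, ha, ha'⟩ := hG.lip x' x p' (hPmem x' v')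
      obtain ⟨a', hb, hb'⟩ := hG.lip x x' p (hPmem x v)
      have i1 := hin x v a ha
      have i2 := hin x' v' a' hb
      have j1 : ⟪v - p, p' - a⟫ ≤ ‖v - p‖ * (c * ‖x' - x‖) :=
        (real_inner_le_norm _ _).trans (by gcongr)
      have j2 : ⟪v' - p', p - a'⟫ ≤ ‖v' - p'‖ * (c * ‖x' - x‖) := by
        rw [norm_sub_rev x x'] at hb'
        exact (real_inner_le_norm _ _).trans (by gcongr)
      have j3 : ⟪v' - v, p' - p⟫ ≤ ‖v' - v‖ * (2 * M) := by
        refine (real_inner_le_norm _ _).trans ?_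
        gcongr
        exact (norm_sub_le _ _).trans (by linarith)
      have e : ‖p' - p‖ ^ 2 = ⟪v' - v, p' - p⟫ + (⟪v - p, p' - a⟫ + ⟪v - p, a - p⟫)
          + (⟪v' - p', p - a'⟫ + ⟪v' - p', a' - p'⟫) := by
        rw [← inner_add_right, ← inner_add_right, ← real_inner_self_eq_norm_sq]
        simp only [sub_add_sub_cancel, inner_sub_left, inner_sub_right]
        ring
      have k1 : ‖v - p‖ ≤ ‖v‖ + M := (norm_sub_le _ _).trans (by linarith)
      have k2 : ‖v' - p'‖ ≤ ‖v'‖ + M := (norm_sub_le _ _).trans (by linarith)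
      have hc : 0 ≤ c * ‖x' - x‖ := mul_nonneg hG.pos.le (norm_nonneg _)
      nlinarith [mul_le_mul_of_nonneg_right k1 hc, mul_le_mul_of_nonneg_right k2 hc]
    rw [continuous_iff_continuousAt]
    rintro ⟨x, v⟩
    have hc : Tendsto (fun q : E × E =>
        ‖q.2 - v‖ * (2 * M) + c * ‖q.1 - x‖ * (‖v‖ + ‖q.2‖ + 2 * M)) (𝓝 (x, v)) (𝓝 0) := by
      have : Continuous (fun q : E × E =>
        ‖q.2 - v‖ * (2 * M) + c * ‖q.1 - x‖ * (‖v‖ + ‖q.2‖ + 2 * M)) := by fun_prop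
      simpa using this.tendsto (x, v)
    have h2 : Tendsto (fun q : E × E => ‖P q.1 q.2 - P x v‖ ^ 2) (𝓝 (x, v)) (𝓝 0) :=
      squeeze_zero (fun q => by positivity) (fun q => key x v q.1 q.2) hc
    have h3 := h2.sqrt
    simp only [Real.sqrt_sq (norm_nonneg _), Real.sqrt_zero] at h3
    exact tendsto_iff_norm_sub_tendsto_zero.2 h3
  · intro x v w hw
    rw [hPeq x v]
    exact ciInf_le ⟨0, by rintro _ ⟨w, rfl⟩; exact norm_nonneg _⟩ (⟨w, hw⟩ : G x)

theorem aestronglyMeasurable_primitive {w : ℝ → E} {a b : ℝ} (hab : a ≤ b) (x : E)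
    (hw : IntervalIntegrable w volume a b) :
    AEStronglyMeasurable (fun s => x + ∫ r in a..s, w r) (volume.restrict (Ioc a b)) := by
  have h : ContinuousOn (fun s => x + ∫ r in a..s, w r) (Ioc a b) := by
    have := intervalIntegral.continuousOn_primitive_interval' hw left_mem_uIcc
    rw [uIcc_of_le hab] at this
    exact continuousOn_const.add (this.mono Ioc_subset_Icc_self)
  exact h.aestronglyMeasurable measurableSet_Ioc

theorem ae_restrict_Ioc_of_ae_Icc {a b : ℝ} {p : ℝ → Prop}
    (h : ∀ᵐ s, s ∈ Icc a b → p s) : ∀ᵐ s ∂volume.restrict (Ioc a b), p s := by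
  rw [ae_restrict_iff' measurableSet_Ioc]
  filter_upwards [h] with s hs h2 using hs (Ioc_subset_Icc_self h2)

theorem ae_Icc_of_ae_Icc {a b s : ℝ} {p : ℝ → Prop} (hs : s ∈ Icc a b)
    (h : ∀ᵐ r, r ∈ Icc a b → p r) : ∀ᵐ r, r ∈ Ioc a s → p r := by
  filter_upwards [h] with r hr h2 using hr ⟨h2.1.le, h2.2.trans hs.2⟩

theorem intervalIntegrable_of_ae_bdd {w : ℝ → E} {a b M : ℝ} (hab : a ≤ b)
    (hm : AEStronglyMeasurable w (volume.restrict (Ioc a b)))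
    (hb : ∀ᵐ s ∂volume.restrict (Ioc a b), ‖w s‖ ≤ M) : IntervalIntegrable w volume a b := by
  rw [intervalIntegrable_iff_integrableOn_Ioc_of_le hab]
  exact IntegrableOn.of_bound (by simp) hm M hb

theorem integral_exp_weight (a s k : ℝ) (hk : k ≠ 0) :
    ∫ r in a..s, Real.exp (k * (r - a)) = (Real.exp (k * (s - a)) - 1) / k := by
  have : ∀ r ∈ uIcc a s, HasDerivAt (fun r => Real.exp (k * (r - a)) / k)
      (Real.exp (k * (r - a))) r := by
    intro r _
    have h1 : HasDerivAt (fun r : ℝ => k * (r - a)) k r := by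
      simpa using ((hasDerivAt_id r).sub_const a).const_mul k
    have := (h1.exp).div_const k
    rwa [mul_div_cancel_right₀ _ hk] at this
  rw [intervalIntegral.integral_eq_sub_of_hasDerivAt this
    (by apply Continuous.intervalIntegrable; fun_prop)]
  simp [sub_div]

/-- Filippov's theorem: near an arc whose velocity is `δ`-close to `G` there is, from every
nearby initial point, a trajectory of `G` whose velocity stays close. -/
theorem TameMap.filippov {G : E → Set E} {c M : ℝ} (hG : TameMap G c M) {a b δ : ℝ}
    (hab : a ≤ b) (hδ : 0 ≤ δ) {w₀ : ℝ → E} (x₀ y₀ : E) (hw₀ : IntervalIntegrable w₀ volume a b)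
    (hdef : ∀ᵐ s, s ∈ Icc a b → ∃ v ∈ G (y₀ + ∫ r in a..s, w₀ r), ‖w₀ s - v‖ ≤ δ) :
    ∃ w : ℝ → E, IntervalIntegrable w volume a b ∧
      (∀ᵐ s, s ∈ Icc a b → w s ∈ G (x₀ + ∫ r in a..s, w r)) ∧
      ∀ᵐ s, s ∈ Icc a b → ‖w s - w₀ s‖ ≤
        2 * (δ + c * ‖x₀ - y₀‖) * Real.exp (2 * c * (s - a)) := by
  obtain ⟨P, hPc, hPmem, hPmin⟩ := hG.exists_proj
  let W : ℕ → ℝ → E := fun k => Nat.rec w₀ (fun _ w s => P (x₀ + ∫ r in a..s, w r) (w s)) k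
  have hW0 : W 0 = w₀ := rfl
  have hWs : ∀ k s, W (k + 1) s = P (x₀ + ∫ r in a..s, W k r) (W k s) := fun k s => rfl
  have hWbd : ∀ k s, ‖W (k + 1) s‖ ≤ M := fun k s => by
    rw [hWs]; exact hG.bdd _ _ (hPmem _ _)
  have hWint : ∀ k, IntervalIntegrable (W k) volume a b := by
    intro k
    induction k with
    | zero => exact hw₀
    | succ k ih =>
      refine intervalIntegrable_of_ae_bdd hab ?_ (.of_forall (hWbd k))
      exact hPc.comp_aestronglyMeasurable
        ((aestronglyMeasurable_primitive hab x₀ ih).prodMk ih.1.aestronglyMeasurable)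
  set D := δ + c * ‖x₀ - y₀‖ with hD
  have hsub : ∀ k, ∀ s ∈ Icc a b, IntervalIntegrable (W k) volume a s := fun k s hs =>
    (hWint k).mono_set (by rw [uIcc_of_le hs.1, uIcc_of_le hab]; exact Icc_subset_Icc_right hs.2)
  have hstep : ∀ k, ∀ᵐ s, s ∈ Icc a b →
      ‖W (k + 1) s - W k s‖ ≤ D * (1 / 2) ^ k * Real.exp (2 * c * (s - a)) := by
    intro k
    induction k with
    | zero =>
      filter_upwards [hdef] with s hs hsI
      obtain ⟨v, hv, hvd⟩ := hs hsI
      obtain ⟨v', hv', hvd'⟩ := hG.lip _ (x₀ + ∫ r in a..s, w₀ r) v hv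
      have h1 := hPmin (x₀ + ∫ r in a..s, w₀ r) (w₀ s) v' hv'
      have h2 : ‖w₀ s - v'‖ ≤ D := by
        have : w₀ s - v' = (w₀ s - v) + (v - v') := by abel
        rw [this]
        refine (norm_add_le _ _).trans ?_
        rw [add_sub_add_right_eq_sub, norm_sub_rev y₀] at hvd'
        linarith
      have h3 : 0 ≤ D := (norm_nonneg _).trans h2
      have h4 : 1 ≤ Real.exp (2 * c * (s - a)) :=
        Real.one_le_exp (mul_nonneg (by linarith [hG.pos]) (by linarith [hsI.1]))
      rw [hWs, hW0, norm_sub_rev]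
      nlinarith
    | succ k ih =>
      refine .of_forall fun s hsI => ?_
      obtain ⟨v', hv', hvd'⟩ := hG.lip _ (x₀ + ∫ r in a..s, W (k + 1) r) _
        (hPmem (x₀ + ∫ r in a..s, W k r) (W k s))
      rw [← hWs] at hvd'
      have h1 := hPmin (x₀ + ∫ r in a..s, W (k + 1) r) (W (k + 1) s) v' hv'
      rw [← hWs (k + 1) s, norm_sub_rev] at h1
      rw [add_sub_add_left_eq_sub, norm_sub_rev (∫ r in a..s, W k r),
        ← intervalIntegral.integral_sub (hsub (k + 1) s hsI) (hsub k s hsI)] at hvd'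
      have h2 : ‖∫ r in a..s, W (k + 1) r - W k r‖ ≤
          ∫ r in a..s, D * (1 / 2) ^ k * Real.exp (2 * c * (r - a)) :=
        intervalIntegral.norm_integral_le_of_norm_le hsI.1 (ae_Icc_of_ae_Icc hsI ih)
          (by apply Continuous.intervalIntegrable; fun_prop)
      rw [intervalIntegral.integral_const_mul, integral_exp_weight _ _ _ (by linarith [hG.pos])]
        at h2
      have hc := hG.pos
      have hDnn : 0 ≤ D * (1 / 2) ^ k := by positivity
      calc _ ≤ ‖W (k + 1) s - v'‖ := h1
        _ ≤ c * ‖∫ r in a..s, W (k + 1) r - W k r‖ := hvd'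
        _ ≤ c * (D * (1 / 2) ^ k * ((Real.exp (2 * c * (s - a)) - 1) / (2 * c))) := by gcongr
        _ = D * (1 / 2) ^ k * (1 / 2) * (Real.exp (2 * c * (s - a)) - 1) := by
          field_simp
        _ ≤ D * (1 / 2) ^ (k + 1) * Real.exp (2 * c * (s - a)) := by
          rw [pow_succ]; nlinarith
  have hall : ∀ᵐ s, ∀ k, s ∈ Icc a b →
      ‖W (k + 1) s - W k s‖ ≤ D * (1 / 2) ^ k * Real.exp (2 * c * (s - a)) :=
    ae_all_iff.2 hstep
  have hdist : ∀ᵐ s, s ∈ Icc a b → ∀ k, dist (W k s) (W (k + 1) s) ≤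
      2 * D * Real.exp (2 * c * (s - a)) / 2 / 2 ^ k := by
    filter_upwards [hall] with s hs hsI k
    rw [dist_comm, dist_eq_norm]
    refine (hs k hsI).trans (le_of_eq ?_)
    rw [div_pow, one_pow]; field_simp
  have hlim : ∀ᵐ s, s ∈ Icc a b → ∃ l, Tendsto (fun k => W k s) atTop (𝓝 l) := by
    filter_upwards [hdist] with s hs hsI
    exact cauchySeq_tendsto_of_complete (cauchySeq_of_le_geometric_two (hs hsI))
  classical
  let w : ℝ → E := fun s => if h : ∃ l, Tendsto (fun k => W k s) atTop (𝓝 l) then h.choose else 0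
  have hw : ∀ᵐ s, s ∈ Icc a b → Tendsto (fun k => W k s) atTop (𝓝 (w s)) := by
    filter_upwards [hlim] with s hs hsI
    have h := hs hsI
    simp only [w, dif_pos h]
    exact h.choose_spec
  have hwm : AEStronglyMeasurable w (volume.restrict (Ioc a b)) :=
    aestronglyMeasurable_of_tendsto_ae atTop (fun k => (hWint k).1.aestronglyMeasurable)
      (ae_restrict_Ioc_of_ae_Icc hw)
  have hwint : IntervalIntegrable w volume a b := by
    refine intervalIntegrable_of_ae_bdd (M := M) hab hwm (ae_restrict_Ioc_of_ae_Icc ?_)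
    filter_upwards [hw] with s hs hsI
    exact le_of_tendsto ((tendsto_add_atTop_iff_nat 1).2 (hs hsI)).norm
      (.of_forall fun k => hWbd k s)
  refine ⟨w, hwint, ?_, ?_⟩
  · have hz : ∀ s ∈ Icc a b, Tendsto (fun k => ∫ r in a..s, W k r) atTop
        (𝓝 (∫ r in a..s, w r)) := by
      intro s hs
      rw [← tendsto_add_atTop_iff_nat 1]
      refine intervalIntegral.tendsto_integral_filter_of_dominated_convergence (fun _ => M)
        (.of_forall fun k => ?_) (.of_forall fun k => ?_) (by simp) ?_
      · rw [uIoc_of_le hs.1]; exact (hsub (k + 1) s hs).1.aestronglyMeasurable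
      · exact .of_forall fun r _ => hWbd k r
      · rw [uIoc_of_le hs.1]
        filter_upwards [ae_Icc_of_ae_Icc hs hw] with r hr h2
        exact (tendsto_add_atTop_iff_nat 1).2 (hr h2)
    filter_upwards [hw] with s hs hsI
    have hz' := hz s hsI
    have hex : ∀ k, ∃ v ∈ G (x₀ + ∫ r in a..s, w r), ‖W (k + 1) s - v‖ ≤
        c * ‖(∫ r in a..s, W k r) - ∫ r in a..s, w r‖ := by
      intro k
      obtain ⟨v, hv, h⟩ := hG.lip _ (x₀ + ∫ r in a..s, w r) _
        (hPmem (x₀ + ∫ r in a..s, W k r) (W k s))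
      rw [← hWs, add_sub_add_left_eq_sub] at h
      exact ⟨v, hv, h⟩
    choose v hv hvd using hex
    have h0 : Tendsto (fun k => W (k + 1) s - v k) atTop (𝓝 0) := by
      refine squeeze_zero_norm hvd ?_
      simpa using ((tendsto_iff_norm_sub_tendsto_zero.1 hz').const_mul c)
    have h1 : Tendsto v atTop (𝓝 (w s)) := by
      simpa using ((tendsto_add_atTop_iff_nat 1).2 (hs hsI)).sub h0
    exact (hG.closed _).mem_of_tendsto h1 (.of_forall hv)
  · filter_upwards [hw, hdist] with s hs hd hsI
    have := dist_le_of_le_geometric_two_of_tendsto₀ (hd hsI) (hs hsI)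
    rwa [dist_comm, dist_eq_norm] at this

/-- `z` can be reached at time `b` along a trajectory of `F` that starts from `x` at time `a`. -/
def Reach (F : E → Set E) (a b : ℝ) (x z : E) : Prop :=
  ∃ w : ℝ → E, IntervalIntegrable w volume a b ∧
    (∀ᵐ s, s ∈ Icc a b → w s ∈ F (x + ∫ r in a..s, w r)) ∧ z = x + ∫ r in a..b, w r

theorem reach_iff_isTraj {F : E → Set E} {a b : ℝ} (hab : a ≤ b) {x z : E} :
    Reach F a b x z ↔ ∃ y y' : ℝ → E, IsTraj F a b y y' ∧ y a = x ∧ z = y b := by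
  constructor
  · rintro ⟨w, hw, hF, rfl⟩
    refine ⟨fun s => x + ∫ r in a..s, w r, w, ⟨⟨hw, fun s _ => by simp, ?_⟩, hF⟩, by simp, rfl⟩
    filter_upwards [hw.ae_hasDerivAt_integral] with s hs hsI
    rw [uIcc_of_le hab] at hs
    exact (hs hsI a (left_mem_Icc.2 hab)).const_add x
  · rintro ⟨y, y', ⟨⟨hi, heq, -⟩, hF⟩, rfl, rfl⟩
    refine ⟨y', hi, ?_, heq b (right_mem_Icc.2 hab)⟩
    filter_upwards [hF] with s hs hsI
    rw [← heq s hsI]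
    exact hs hsI

theorem valueFn_eq_sInf_reach (F : E → Set E) (φ : E → ℝ) {t T : ℝ} (h : t ≤ T) (x : E) :
    valueFn F φ T t x = sInf (φ '' {z | Reach F t T x z}) := by
  unfold valueFn
  congr 1
  ext r
  simp only [mem_ofPred_eq, mem_image, reach_iff_isTraj h]
  constructor
  · rintro ⟨y, y', h1, h2, rfl⟩
    exact ⟨y T, ⟨y, y', h1, h2, rfl⟩, rfl⟩
  · rintro ⟨z, ⟨y, y', h1, h2, rfl⟩, rfl⟩
    exact ⟨y, y', h1, h2, rfl⟩

theorem reach_self {F : E → Set E} {a : ℝ} {x z : E} : Reach F a a x z ↔ z = x := by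
  constructor
  · rintro ⟨w, -, -, rfl⟩
    simp
  · rintro rfl
    refine ⟨0, by simp, ?_, by simp⟩
    have : ∀ᵐ s : ℝ, s ≠ a := by simp [ae_iff, measure_singleton]
    filter_upwards [this] with s hs hsI
    exact absurd (le_antisymm hsI.2 hsI.1) hs

theorem Reach.trans {F : E → Set E} {a b c : ℝ} (hab : a ≤ b) (hbc : b ≤ c) {x y z : E}
    (h1 : Reach F a b x y) (h2 : Reach F b c y z) : Reach F a c x z := by
  obtain ⟨w₁, i1, m1, rfl⟩ := h1
  obtain ⟨w₂, i2, m2, rfl⟩ := h2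
  let w : ℝ → E := fun s => if s ≤ b then w₁ s else w₂ s
  have e1 : ∀ s ≤ b, w s = w₁ s := fun s hs => if_pos hs
  have e2 : ∀ s, b < s → w s = w₂ s := fun s hs => if_neg (not_le.2 hs)
  have j1 : IntervalIntegrable w volume a b := by
    refine i1.congr fun s hs => ?_
    rw [uIoc_of_le hab] at hs
    exact (e1 s hs.2).symm
  have j2 : IntervalIntegrable w volume b c := by
    refine i2.congr fun s hs => ?_
    rw [uIoc_of_le hbc] at hs
    exact (e2 s hs.1).symm
  have k1 : ∀ s ∈ Icc a b, ∫ r in a..s, w r = ∫ r in a..s, w₁ r := by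
    intro s hs
    refine intervalIntegral.integral_congr_ae (.of_forall fun r hr => ?_)
    rw [uIoc_of_le hs.1] at hr
    exact e1 r (hr.2.trans hs.2)
  have k2 : ∀ s ∈ Icc b c, ∫ r in a..s, w r = (∫ r in a..b, w₁ r) + ∫ r in b..s, w₂ r := by
    intro s hs
    have j3 : IntervalIntegrable w volume b s := j2.mono_set (by
      rw [uIcc_of_le hs.1, uIcc_of_le hbc]; exact Icc_subset_Icc_right hs.2)
    rw [← intervalIntegral.integral_add_adjacent_intervals j1 j3, k1 b ⟨hab, le_rfl⟩]
    congr 1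
    refine intervalIntegral.integral_congr_ae (.of_forall fun r hr => ?_)
    rw [uIoc_of_le hs.1] at hr
    exact e2 r hr.1
  refine ⟨w, j1.trans j2, ?_, ?_⟩
  · filter_upwards [m1, m2] with s h1 h2 hs
    rcases le_or_gt s b with h | h
    · rw [k1 s ⟨hs.1, h⟩, e1 s h]
      exact h1 ⟨hs.1, h⟩
    · rw [k2 s ⟨h.le, hs.2⟩, e2 s h, ← add_assoc]
      exact h2 ⟨h.le, hs.2⟩
  · rw [k2 c ⟨hbc, le_rfl⟩, add_assoc]

theorem Reach.split {F : E → Set E} {a b c : ℝ} (hab : a ≤ b) (hbc : b ≤ c) {x z : E}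
    (h : Reach F a c x z) : ∃ y, Reach F a b x y ∧ Reach F b c y z := by
  obtain ⟨w, i, m, rfl⟩ := h
  have hac := hab.trans hbc
  have j1 : IntervalIntegrable w volume a b := i.mono_set (by
    rw [uIcc_of_le hab, uIcc_of_le hac]; exact Icc_subset_Icc_right hbc)
  have j2 : IntervalIntegrable w volume b c := i.mono_set (by
    rw [uIcc_of_le hbc, uIcc_of_le hac]; exact Icc_subset_Icc_left hab)
  have k : ∀ s ∈ Icc b c, (x + ∫ r in a..b, w r) + ∫ r in b..s, w r = x + ∫ r in a..s, w r := by
    intro s hs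
    have j3 : IntervalIntegrable w volume b s := j2.mono_set (by
      rw [uIcc_of_le hs.1, uIcc_of_le hbc]; exact Icc_subset_Icc_right hs.2)
    rw [add_assoc, intervalIntegral.integral_add_adjacent_intervals j1 j3]
  refine ⟨x + ∫ r in a..b, w r, ⟨w, j1, ?_, rfl⟩, w, j2, ?_, (k c ⟨hbc, le_rfl⟩).symm⟩
  · filter_upwards [m] with s hs hsI using hs ⟨hsI.1, hsI.2.trans hbc⟩
  · filter_upwards [m] with s hs hsI
    rw [k s hsI]
    exact hs ⟨hab.trans hsI.1, hsI.2⟩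

/-- A priori bound for arcs with velocity of sublinear growth. -/
theorem norm_primitive_le_of_growth {a b r : ℝ} (hab : a ≤ b) (hr : 0 < r) {x : E}
    {w : ℝ → E} (hw : IntervalIntegrable w volume a b)
    (h : ∀ᵐ s, s ∈ Icc a b → ‖w s‖ ≤ r * (1 + ‖x + ∫ q in a..s, w q‖)) :
    ∀ s ∈ Icc a b, 1 + ‖x + ∫ q in a..s, w q‖ ≤ 2 * (1 + ‖x‖) * Real.exp (2 * r * (s - a)) := by
  have hcont : ContinuousOn (fun s => x + ∫ q in a..s, w q) (Icc a b) := by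
    have := intervalIntegral.continuousOn_primitive_interval' hw left_mem_uIcc
    rw [uIcc_of_le hab] at this
    exact continuousOn_const.add this
  have hc2 : ContinuousOn (fun s => (1 + ‖x + ∫ q in a..s, w q‖) * Real.exp (-(2 * r * (s - a))))
      (Icc a b) := by
    refine (continuousOn_const.add hcont.norm).mul ?_
    fun_prop
  obtain ⟨σ, hσ, hmax⟩ := isCompact_Icc.exists_isMaxOn (nonempty_Icc.2 hab) hc2
  set m := (1 + ‖x + ∫ q in a..σ, w q‖) * Real.exp (-(2 * r * (σ - a))) with hm
  have hle : ∀ s ∈ Icc a b, 1 + ‖x + ∫ q in a..s, w q‖ ≤ m * Real.exp (2 * r * (s - a)) := by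
    intro s hs
    have h1 : (1 + ‖x + ∫ q in a..s, w q‖) * Real.exp (-(2 * r * (s - a))) ≤ m := hmax hs
    rwa [Real.exp_neg, ← div_eq_mul_inv, div_le_iff₀ (Real.exp_pos _)] at h1
  have hint : ‖∫ q in a..σ, w q‖ ≤ ∫ q in a..σ, r * m * Real.exp (2 * r * (q - a)) := by
    refine intervalIntegral.norm_integral_le_of_norm_le hσ.1 ?_
      (by apply Continuous.intervalIntegrable; fun_prop)
    filter_upwards [h] with s hs hsI
    have hsI' : s ∈ Icc a b := ⟨hsI.1.le, hsI.2.trans hσ.2⟩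
    rw [mul_assoc]
    exact (hs hsI').trans (mul_le_mul_of_nonneg_left (hle s hsI') hr.le)
  rw [intervalIntegral.integral_const_mul, integral_exp_weight _ _ _ (by positivity)] at hint
  have hmeq : 1 + ‖x + ∫ q in a..σ, w q‖ = m * Real.exp (2 * r * (σ - a)) := by
    rw [hm, mul_assoc, ← Real.exp_add]; simp
  have hm0 : 0 < m := by positivity
  have hb : m * Real.exp (2 * r * (σ - a)) ≤
      1 + ‖x‖ + m * (Real.exp (2 * r * (σ - a)) - 1) / 2 := by
    rw [← hmeq]
    have e : r * m * ((Real.exp (2 * r * (σ - a)) - 1) / (2 * r)) =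
      m * (Real.exp (2 * r * (σ - a)) - 1) / 2 := by field_simp
    rw [e] at hint
    linarith [norm_add_le x (∫ q in a..σ, w q)]
  have hE : 1 ≤ Real.exp (2 * r * (σ - a)) :=
    Real.one_le_exp (mul_nonneg (by linarith) (by linarith [hσ.1]))
  have hm2 : m ≤ 2 * (1 + ‖x‖) := by nlinarith
  intro s hs
  exact (hle s hs).trans (by gcongr)

theorem exists_retraction_closedBall {R : ℝ} (hR : 0 ≤ R) :
    ∃ π : E → E, (∀ x y, ‖π x - π y‖ ≤ ‖x - y‖) ∧ (∀ x, ‖π x‖ ≤ R) ∧ (∀ x, ‖π x‖ ≤ ‖x‖) ∧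
      ∀ x, ‖x‖ ≤ R → π x = x := by
  have hc : Convex ℝ (closedBall (0 : E) R) := convex_closedBall 0 R
  have h1 : ∀ x : E, ∃ p ∈ closedBall (0 : E) R, ‖x - p‖ = ⨅ w : closedBall (0 : E) R, ‖x - w‖ :=
    exists_norm_eq_iInf_of_complete_convex ⟨0, by simpa⟩ isClosed_closedBall.isComplete hc
  choose P hPmem hPeq using h1
  have hin : ∀ x, ∀ w ∈ closedBall (0 : E) R, ⟪x - P x, w - P x⟫ ≤ 0 := fun x =>
    (norm_eq_iInf_iff_real_inner_le_zero hc (hPmem x)).1 (hPeq x)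
  have hlip : ∀ x y, ‖P x - P y‖ ≤ ‖x - y‖ := by
    intro x y
    have i1 := hin x _ (hPmem y)
    have i2 := hin y _ (hPmem x)
    have e : ‖P x - P y‖ ^ 2 = ⟪x - y, P x - P y⟫ + ⟪x - P x, P y - P x⟫ +
        ⟪y - P y, P x - P y⟫ := by
      rw [← real_inner_self_eq_norm_sq]
      simp only [inner_sub_left, inner_sub_right]
      ring
    have := real_inner_le_norm (x - y) (P x - P y)
    by_contra! hlt
    nlinarith [norm_nonneg (x - y), norm_nonneg (P x - P y)]
  have hid : ∀ x, ‖x‖ ≤ R → P x = x := by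
    intro x hx
    have := hin x x (by simpa using hx)
    rw [real_inner_self_eq_norm_sq] at this
    have h0 : ‖x - P x‖ = 0 := by
      nlinarith [norm_nonneg (x - P x)]
    exact (sub_eq_zero.1 (norm_eq_zero.1 h0)).symm
  refine ⟨P, hlip, fun x => by simpa using hPmem x, fun x => ?_, hid⟩
  have := hlip x 0
  rwa [hid 0 (by simpa using hR), sub_zero, sub_zero] at this

theorem StandingHyp.lipschitz_closedBall [ProperSpace E] {F : E → Set E} (hF : StandingHyp F)
    (R : ℝ) : ∃ c > (0:ℝ), ∀ x ∈ closedBall (0 : E) R, ∀ y ∈ closedBall (0 : E) R,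
      ∀ v ∈ F x, ∃ w ∈ F y, ‖v - w‖ ≤ c * ‖x - y‖ := by
  let f : E → TopologicalSpace.NonemptyCompacts E := fun x => ⟨⟨F x, (hF.1 x).2.2⟩, (hF.1 x).1⟩
  have hf : LocallyLipschitz f := by
    intro x
    obtain ⟨ε, hε, c, hc, h⟩ := hF.2.1 x
    refine ⟨c.toNNReal, ball x ε, ball_mem_nhds x hε, fun y hy z hz => ?_⟩
    have h1 := h y hy z hz
    rw [ENNReal.ofReal_mul hc, ← edist_dist] at h1
    exact h1
  obtain ⟨K, hK⟩ := (hf.locallyLipschitzOn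
    (s := closedBall (0 : E) R)).exists_lipschitzOnWith_of_compact (isCompact_closedBall 0 R)
  refine ⟨K + 1, by positivity, fun x hx y hy v hv => ?_⟩
  obtain ⟨w, hw, h2⟩ := (hF.1 y).2.2.exists_infEDist_eq_edist (hF.1 y).1 v
  refine ⟨w, hw, ?_⟩
  have h3 : edist v w ≤ K * edist x y := by
    rw [← h2]
    exact (infEDist_le_hausdorffEDist_of_mem (t := F y) hv).trans (hK hx hy)
  have h4 := ENNReal.toReal_mono (by finiteness) h3
  rw [ENNReal.toReal_mul, ← dist_edist, ← dist_edist, dist_eq_norm, dist_eq_norm] at h4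
  simp only [ENNReal.coe_toReal] at h4
  nlinarith [norm_nonneg (x - y)]

/-- Truncation: inside a ball `F` agrees with a bounded, globally Lipschitz set-valued map. -/
theorem StandingHyp.exists_tameMap [ProperSpace E] {F : E → Set E} (hF : StandingHyp F) {r : ℝ}
    (hr : 0 < r) (hgr : ∀ x, ∀ v ∈ F x, ‖v‖ ≤ r * (1 + ‖x‖)) {R : ℝ} (hR : 0 ≤ R) :
    ∃ G : E → Set E, ∃ c M : ℝ, TameMap G c M ∧ (∀ x, ‖x‖ ≤ R → G x = F x) ∧
      ∀ x, ∀ v ∈ G x, ‖v‖ ≤ r * (1 + ‖x‖) := by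
  obtain ⟨π, hlip, hbd, hle, hid⟩ := exists_retraction_closedBall (E := E) hR
  obtain ⟨c, hc, hFc⟩ := hF.lipschitz_closedBall R
  refine ⟨fun x => F (π x), c, r * (1 + R), ⟨hc, by positivity, fun x => (hF.1 _).1,
    fun x => (hF.1 _).2.1, fun x => (hF.1 _).2.2.isClosed, fun x v hv => ?_, fun x y v hv => ?_⟩,
    fun x hx => congrArg F (hid x hx), fun x v hv => ?_⟩
  · exact (hgr _ v hv).trans (by gcongr; exact hbd x)
  · obtain ⟨w, hw, h⟩ := hFc (π x) (by simpa using hbd x) (π y) (by simpa using hbd y) v hv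
    exact ⟨w, hw, h.trans (by gcongr; exact hlip x y)⟩
  · exact (hgr _ v hv).trans (by gcongr; exact hle x)

theorem StandingHyp.inner_le_ham {F : E → Set E} (hF : StandingHyp F) {x v : E} (hv : v ∈ F x)
    (p : E) : ⟪v, p⟫ ≤ Ham F x p := by
  have hc : IsCompact ((fun v => ⟪v, p⟫) '' F x) := (hF.1 x).2.2.image (by fun_prop)
  exact le_csSup hc.bddAbove ⟨v, hv, rfl⟩

theorem StandingHyp.ham_le {F : E → Set E} (hF : StandingHyp F) {x p : E} {m : ℝ}
    (h : ∀ v ∈ F x, ⟪v, p⟫ ≤ m) : Ham F x p ≤ m := by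
  refine csSup_le ((hF.1 x).1.image _) ?_
  rintro _ ⟨v, hv, rfl⟩
  exact h v hv

theorem Reach.of_forall_ball {F G : E → Set E} {r R a b : ℝ} {x z : E} (hab : a ≤ b) (hr : 0 < r)
    (hgr : ∀ x, ∀ v ∈ F x, ‖v‖ ≤ r * (1 + ‖x‖)) (hFG : ∀ x, ‖x‖ ≤ R → F x ⊆ G x)
    (hR : 2 * (1 + ‖x‖) * Real.exp (2 * r * (b - a)) ≤ R) (h : Reach F a b x z) :
    Reach G a b x z ∧ ‖z‖ ≤ R := by
  obtain ⟨w, hw, hm, rfl⟩ := h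
  have hle : ∀ s ∈ Icc a b, ‖x + ∫ q in a..s, w q‖ ≤ R := by
    intro s hs
    have h1 := norm_primitive_le_of_growth hab hr hw
      (by filter_upwards [hm] with s hs hsI using hgr _ _ (hs hsI)) s hs
    have h2 : Real.exp (2 * r * (s - a)) ≤ Real.exp (2 * r * (b - a)) := by
      gcongr; exact hs.2
    nlinarith [norm_nonneg x]
  refine ⟨⟨w, hw, ?_, rfl⟩, hle b ⟨hab, le_rfl⟩⟩
  filter_upwards [hm] with s hs hsI
  exact hFG _ (hle s hsI) (hs hsI)

theorem TameMap.exists_reach {G : E → Set E} {c M : ℝ} (hG : TameMap G c M) {a b δ : ℝ}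
    (hab : a ≤ b) (hδ : 0 ≤ δ) {w₀ : ℝ → E} (x₀ y₀ : E) (hw₀ : IntervalIntegrable w₀ volume a b)
    (hdef : ∀ᵐ s, s ∈ Icc a b → ∃ v ∈ G (y₀ + ∫ r in a..s, w₀ r), ‖w₀ s - v‖ ≤ δ) :
    ∃ z, Reach G a b x₀ z ∧ ‖(z - x₀) - ∫ r in a..b, w₀ r‖ ≤
      2 * (δ + c * ‖x₀ - y₀‖) * Real.exp (2 * c * (b - a)) * (b - a) := by
  obtain ⟨w, hw, hm, hd⟩ := hG.filippov hab hδ x₀ y₀ hw₀ hdef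
  refine ⟨_, ⟨w, hw, hm, rfl⟩, ?_⟩
  rw [add_sub_cancel_left, ← intervalIntegral.integral_sub hw hw₀]
  have hc := hG.pos
  have : ∀ᵐ s, s ∈ uIoc a b → ‖w s - w₀ s‖ ≤
      2 * (δ + c * ‖x₀ - y₀‖) * Real.exp (2 * c * (b - a)) := by
    rw [uIoc_of_le hab]
    filter_upwards [hd] with s hs hsI
    refine (hs (Ioc_subset_Icc_self hsI)).trans ?_
    gcongr
    exact hsI.2
  have h2 := intervalIntegral.norm_integral_le_of_norm_le_const_ae this
  rwa [abs_of_nonneg (sub_nonneg.2 hab)] at h2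

/-- Uniform estimates for the reachable sets from points of the ball of radius `ρ`, over time
intervals of length at most `T`. -/
structure ReachBounds (F : E → Set E) (T ρ R C : ℝ) : Prop where
  le : ρ ≤ R
  nonneg : 0 ≤ C
  norm_le : ∀ {a b x z}, a ≤ b → b - a ≤ T → ‖x‖ ≤ ρ → Reach F a b x z → ‖z‖ ≤ R
  norm_sub_le : ∀ {a b x z}, a ≤ b → b - a ≤ T → ‖x‖ ≤ ρ → Reach F a b x z →
    ‖z - x‖ ≤ C * (b - a)
  lipschitz : ∀ {a b x z}, a ≤ b → b - a ≤ T → ‖x‖ ≤ ρ → Reach F a b x z →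
    ∀ y, ‖y‖ ≤ ρ → ∃ z', Reach F a b y z' ∧ ‖z - z'‖ ≤ C * ‖x - y‖
  exists_velocity : ∀ {a b x}, a ≤ b → b - a ≤ T → ‖x‖ ≤ ρ → ∀ v ∈ F x,
    ∃ z, Reach F a b x z ∧ ‖z - x - (b - a) • v‖ ≤ C * (b - a) ^ 2
  inner_le : ∀ {a b x z}, a ≤ b → b - a ≤ T → ‖x‖ ≤ ρ → Reach F a b x z → ∀ p,
    ⟪z - x, p⟫ ≤ (b - a) * (Ham F x p + C * (b - a) * ‖p‖)

theorem StandingHyp.exists_reachBounds [ProperSpace E] {F : E → Set E} (hF : StandingHyp F)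
    (T : ℝ) {ρ : ℝ} (hρ : 0 ≤ ρ) : ∃ R C, ReachBounds F T ρ R C := by
  obtain ⟨r, hr, hgr⟩ := hF.2.2
  rcases lt_or_ge T 0 with hT | hT
  · exact ⟨ρ, 0, le_rfl, le_rfl, fun _ _ => by linarith, fun _ _ => by linarith,
      fun _ _ => by linarith, fun _ _ => by linarith, fun _ _ => by linarith⟩
  set R := 2 * (1 + ρ) * Real.exp (2 * r * T) with hRdef
  have hexp : 1 ≤ Real.exp (2 * r * T) := Real.one_le_exp (by positivity)
  have hρR : ρ ≤ R := by nlinarith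
  have hRx : ∀ {a b : ℝ} {x : E}, b - a ≤ T → ‖x‖ ≤ ρ →
      2 * (1 + ‖x‖) * Real.exp (2 * r * (b - a)) ≤ R := by
    intro a b x h1 h2
    rw [hRdef]
    gcongr
  obtain ⟨G, c, M, hG, hGF, hgrG⟩ := hF.exists_tameMap hr hgr (hρ.trans hρR)
  have hto : ∀ {a b : ℝ} {x z : E}, a ≤ b → b - a ≤ T → ‖x‖ ≤ ρ → Reach F a b x z →
      Reach G a b x z ∧ ‖z‖ ≤ R := fun hab hT hx h =>
    h.of_forall_ball hab hr hgr (fun x hx => (hGF x hx).ge) (hRx hT hx)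
  have hfrom : ∀ {a b : ℝ} {x z : E}, a ≤ b → b - a ≤ T → ‖x‖ ≤ ρ → Reach G a b x z →
      Reach F a b x z := fun hab hT hx h =>
    (h.of_forall_ball hab hr hgrG (fun x hx => (hGF x hx).le) (hRx hT hx)).1
  have hc := hG.pos
  have hM := hG.nonneg
  have hsub : ∀ {a b : ℝ} {x z : E}, a ≤ b → Reach G a b x z → ‖z - x‖ ≤ M * (b - a) := by
    rintro a b x z hab ⟨w, hw, hm, rfl⟩
    rw [add_sub_cancel_left]
    have : ∀ᵐ s, s ∈ uIoc a b → ‖w s‖ ≤ M := by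
      rw [uIoc_of_le hab]
      filter_upwards [hm] with s hs hsI using hG.bdd _ _ (hs (Ioc_subset_Icc_self hsI))
    have h2 := intervalIntegral.norm_integral_le_of_norm_le_const_ae this
    rwa [abs_of_nonneg (sub_nonneg.2 hab)] at h2
  set e := Real.exp (2 * c * T) with he
  have he0 : 0 < e := Real.exp_pos _
  have hee : ∀ {a b : ℝ}, b - a ≤ T → Real.exp (2 * c * (b - a)) ≤ e := fun h => by
    rw [he]; gcongr
  refine ⟨R, M + (1 + 2 * c * e * T) + 2 * c * M * e + c * M, hρR, by positivity,
    fun hab hT hx h => (hto hab hT hx h).2, ?_, ?_, ?_, ?_⟩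
  · intro a b x z hab hbT hx h
    refine (hsub hab (hto hab hbT hx h).1).trans ?_
    have : 0 ≤ b - a := sub_nonneg.2 hab
    gcongr
    have : 0 ≤ 1 + 2 * c * e * T + 2 * c * M * e + c * M := by positivity
    linarith
  · intro a b x z hab hbT hx h y hy
    obtain ⟨w₀, hw₀, hm, rfl⟩ := (hto hab hbT hx h).1
    obtain ⟨z', hz', hd⟩ := hG.exists_reach hab le_rfl y x hw₀
      (by filter_upwards [hm] with s hs hsI using ⟨_, hs hsI, by simp⟩)
    refine ⟨z', hfrom hab hbT hy hz', ?_⟩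
    have e1 : (x + ∫ r in a..b, w₀ r) - z' = (x - y) - ((z' - y) - ∫ r in a..b, w₀ r) := by abel
    rw [e1]
    refine (_root_.norm_sub_le _ _).trans ?_
    rw [zero_add, norm_sub_rev y x] at hd
    have h3 : 2 * (c * ‖x - y‖) * Real.exp (2 * c * (b - a)) * (b - a) ≤
        2 * (c * ‖x - y‖) * e * T := by
      have := sub_nonneg.2 hab
      gcongr
      exact hee hbT
    have h4 : 0 ≤ (M + 2 * c * M * e + c * M) * ‖x - y‖ := by positivity
    nlinarith
  · intro a b x hab hbT hx v hv
    have hba := sub_nonneg.2 hab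
    rw [← hGF x (hx.trans hρR)] at hv
    obtain ⟨z, hz, hd⟩ := hG.exists_reach (δ := c * (M * (b - a))) hab (by positivity)
      (w₀ := fun _ => v) x x (by simp) (.of_forall fun s hs => by
        obtain ⟨v', hv', h⟩ := hG.lip _ (x + ∫ r in a..s, v) v hv
        refine ⟨v', hv', h.trans ?_⟩
        rw [sub_add_cancel_left, norm_neg, intervalIntegral.integral_const, norm_smul,
          Real.norm_eq_abs, abs_of_nonneg (sub_nonneg.2 hs.1), mul_comm (s - a)]
        have := sub_nonneg.2 hs.1
        gcongr
        · exact hG.bdd _ _ hv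
        · exact hs.2)
    refine ⟨z, hfrom hab hbT hx hz, ?_⟩
    rw [intervalIntegral.integral_const] at hd
    refine hd.trans ?_
    rw [sub_self, norm_zero, mul_zero, add_zero]
    have h3 : 2 * (c * (M * (b - a))) * Real.exp (2 * c * (b - a)) * (b - a) ≤
        2 * (c * (M * (b - a))) * e * (b - a) := by
      gcongr
      exact hee hbT
    have h4 : 0 ≤ (M + (1 + 2 * c * e * T) + c * M) * (b - a) ^ 2 := by positivity
    nlinarith
  · intro a b x z hab hbT hx h p
    have hba := sub_nonneg.2 hab
    obtain ⟨w, hw, hm, rfl⟩ := (hto hab hbT hx h).1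
    rw [add_sub_cancel_left, real_inner_comm]
    have hcomm := (innerSL ℝ p).intervalIntegral_comp_comm hw
    simp only [innerSL_apply_apply] at hcomm
    rw [← hcomm]
    have hi : IntervalIntegrable (fun s => ⟪p, w s⟫) volume a b :=
      ⟨(innerSL ℝ p).integrable_comp hw.1, (innerSL ℝ p).integrable_comp hw.2⟩
    have hb : ∀ᵐ s, s ∈ Icc a b → ⟪p, w s⟫ ≤ Ham F x p + c * M * (b - a) * ‖p‖ := by
      filter_upwards [hm] with s hs hsI
      obtain ⟨v, hv, hd⟩ := hG.lip _ x _ (hs hsI)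
      rw [hGF x (hx.trans hρR)] at hv
      have h1 := hF.inner_le_ham hv p
      have h2 : ‖x + (∫ r in a..s, w r) - x‖ ≤ M * (s - a) := by
        refine hsub hsI.1 ⟨w, hw.mono_set ?_, ?_, rfl⟩
        · rw [uIcc_of_le hsI.1, uIcc_of_le hab]; exact Icc_subset_Icc_right hsI.2
        · filter_upwards [hm] with q hq hqI using hq ⟨hqI.1, hqI.2.trans hsI.2⟩
      have h3 : ⟪w s - v, p⟫ ≤ c * M * (b - a) * ‖p‖ := by
        refine (real_inner_le_norm _ _).trans ?_
        gcongr
        refine hd.trans ?_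
        rw [mul_assoc]
        gcongr
        exact h2.trans (by gcongr; exact hsI.2)
      rw [real_inner_comm]
      rw [inner_sub_left] at h3
      linarith
    have h5 : ∫ s in a..b, ⟪p, w s⟫ ≤ ∫ _ in a..b, (Ham F x p + c * M * (b - a) * ‖p‖) := by
      rw [intervalIntegral.integral_of_le hab, intervalIntegral.integral_of_le hab]
      exact integral_mono_ae hi.1 (by simp) (ae_restrict_Ioc_of_ae_Icc hb)
    rw [intervalIntegral.integral_const, smul_eq_mul] at h5
    refine h5.trans ?_
    have h6 : 0 ≤ (M + (1 + 2 * c * e * T) + 2 * c * M * e) * (b - a) * ‖p‖ := by positivity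
    gcongr
    have : 0 ≤ M + (1 + 2 * c * e * T) + 2 * c * M * e := by positivity
    linarith

section ValueFunction

variable [ProperSpace E] {F : E → Set E} {φ : E → ℝ} {T : ℝ}

theorem StandingHyp.reach_nonempty (hF : StandingHyp F) {a b : ℝ} (hab : a ≤ b) (x : E) :
    {z | Reach F a b x z}.Nonempty := by
  obtain ⟨R, C, h⟩ := hF.exists_reachBounds (b - a) (norm_nonneg x)
  obtain ⟨v, hv⟩ := (hF.1 x).1
  obtain ⟨z, hz, -⟩ := h.exists_velocity hab le_rfl le_rfl v hv
  exact ⟨z, hz⟩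

theorem StandingHyp.bddBelow_image_reach (hF : StandingHyp F) (hφ : Continuous φ) {a b : ℝ}
    (hab : a ≤ b) (x : E) : BddBelow (φ '' {z | Reach F a b x z}) := by
  obtain ⟨R, C, h⟩ := hF.exists_reachBounds (b - a) (norm_nonneg x)
  refine ((isCompact_closedBall (0 : E) R).bddBelow_image hφ.continuousOn).mono ?_
  refine image_mono fun z hz => ?_
  simpa using h.norm_le hab le_rfl le_rfl hz

theorem StandingHyp.valueFn_le (hF : StandingHyp F) (hφ : Continuous φ) {t : ℝ} (ht : t ≤ T)
    {x z : E} (h : Reach F t T x z) : valueFn F φ T t x ≤ φ z := by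
  rw [valueFn_eq_sInf_reach F φ ht]
  exact csInf_le (hF.bddBelow_image_reach hφ ht x) ⟨z, h, rfl⟩

theorem StandingHyp.exists_reach_lt (hF : StandingHyp F) {t ε : ℝ} (ht : t ≤ T) (x : E)
    (hε : 0 < ε) : ∃ z, Reach F t T x z ∧ φ z < valueFn F φ T t x + ε := by
  rw [valueFn_eq_sInf_reach F φ ht]
  obtain ⟨_, ⟨z, hz, rfl⟩, h⟩ := exists_lt_of_csInf_lt ((hF.reach_nonempty ht x).image φ)
    (lt_add_of_pos_right (sInf (φ '' {z | Reach F t T x z})) hε)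
  exact ⟨z, hz, h⟩

theorem valueFn_terminal (F : E → Set E) (φ : E → ℝ) (T : ℝ) (x : E) :
    valueFn F φ T T x = φ x := by
  rw [valueFn_eq_sInf_reach F φ le_rfl]
  simp [reach_self]

theorem StandingHyp.valueFn_le_of_reach (hF : StandingHyp F) (hφ : Continuous φ) {t s : ℝ}
    (hts : t ≤ s) (hs : s ≤ T) {x y : E} (h : Reach F t s x y) :
    valueFn F φ T t x ≤ valueFn F φ T s y := by
  refine le_of_forall_pos_le_add fun ε hε => ?_
  obtain ⟨z, hz, hlt⟩ := hF.exists_reach_lt (φ := φ) hs y hε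
  exact (hF.valueFn_le hφ (hts.trans hs) (h.trans hts hs hz)).trans hlt.le

theorem StandingHyp.exists_reach_valueFn_lt (hF : StandingHyp F) (hφ : Continuous φ) {t s ε : ℝ}
    (hts : t ≤ s) (hs : s ≤ T) (x : E) (hε : 0 < ε) :
    ∃ y, Reach F t s x y ∧ valueFn F φ T s y < valueFn F φ T t x + ε := by
  obtain ⟨z, hz, hlt⟩ := hF.exists_reach_lt (φ := φ) (hts.trans hs) x hε
  obtain ⟨y, h1, h2⟩ := hz.split hts hs
  exact ⟨y, h1, (hF.valueFn_le hφ hs h2).trans_lt hlt⟩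

theorem StandingHyp.valueFn_lipschitz_space (hF : StandingHyp F) (hφ : LocallyLipschitz φ)
    {ρ : ℝ} (hρ : 0 ≤ ρ) : ∃ L : ℝ, 0 ≤ L ∧ ∀ t ∈ Icc 0 T, ∀ x y : E, ‖x‖ ≤ ρ → ‖y‖ ≤ ρ →
      valueFn F φ T t x ≤ valueFn F φ T t y + L * ‖x - y‖ := by
  obtain ⟨R, C, h⟩ := hF.exists_reachBounds T hρ
  obtain ⟨K, hK⟩ := (hφ.locallyLipschitzOn
    (s := closedBall (0 : E) R)).exists_lipschitzOnWith_of_compact (isCompact_closedBall 0 R)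
  have hC := h.nonneg
  refine ⟨K * C, by positivity, fun t ht x y hx hy => ?_⟩
  refine le_of_forall_pos_le_add fun ε hε => ?_
  have hT : T - t ≤ T := by linarith [ht.1]
  obtain ⟨z, hz, hlt⟩ := hF.exists_reach_lt (φ := φ) ht.2 y hε
  obtain ⟨z', hz', hd⟩ := h.lipschitz ht.2 hT hy hz x hx
  have h1 := hF.valueFn_le hφ.continuous ht.2 hz'
  have h2 := hK.dist_le_mul z' (by simpa using h.norm_le ht.2 hT hx hz') z
    (by simpa using h.norm_le ht.2 hT hy hz)
  rw [Real.dist_eq, dist_eq_norm, norm_sub_rev] at h2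
  have h3 := (abs_le.1 h2).2
  rw [norm_sub_rev y x] at hd
  have h4 : (K : ℝ) * ‖z - z'‖ ≤ K * (C * ‖x - y‖) := by gcongr
  linarith

theorem StandingHyp.valueFn_lipschitz (hF : StandingHyp F) (hφ : LocallyLipschitz φ)
    {ρ : ℝ} (hρ : 0 ≤ ρ) : ∃ L : ℝ≥0, LipschitzOnWith L
      (fun q : ℝ × E => valueFn F φ T q.1 q.2) (Icc 0 T ×ˢ closedBall 0 ρ) := by
  obtain ⟨R, C, h⟩ := hF.exists_reachBounds T hρ
  have hC := h.nonneg
  obtain ⟨L, hL0, hL⟩ := hF.valueFn_lipschitz_space (T := T) hφ (hρ.trans h.le)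
  have htime : ∀ t ∈ Icc 0 T, ∀ s ∈ Icc 0 T, t ≤ s → ∀ x : E, ‖x‖ ≤ ρ →
      |valueFn F φ T t x - valueFn F φ T s x| ≤ L * C * (s - t) := by
    intro t ht s hs hts x hx
    have hst : s - t ≤ T := by linarith [ht.1, hs.2]
    have hbd : ∀ y, Reach F t s x y → ‖y‖ ≤ R ∧ L * ‖y - x‖ ≤ L * C * (s - t) := by
      intro y hy
      refine ⟨h.norm_le hts hst hx hy, ?_⟩
      rw [mul_assoc]
      exact mul_le_mul_of_nonneg_left (h.norm_sub_le hts hst hx hy) hL0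
    rw [abs_le]
    constructor
    · have : valueFn F φ T s x ≤ valueFn F φ T t x + L * C * (s - t) := by
        refine le_of_forall_pos_le_add fun ε hε => ?_
        obtain ⟨y, hy, hlt⟩ := hF.exists_reach_valueFn_lt hφ.continuous hts hs.2 x hε
        have h1 := hL s hs x y (hx.trans h.le) (hbd y hy).1
        have h2 := (hbd y hy).2
        rw [norm_sub_rev] at h2
        linarith
      linarith
    · obtain ⟨y, hy⟩ := hF.reach_nonempty hts x
      have h1 := hF.valueFn_le_of_reach hφ.continuous hts hs.2 hy
      have h2 := hL s hs y x (hbd y hy).1 (hx.trans h.le)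
      linarith [(hbd y hy).2]
  refine ⟨(L * C + L).toNNReal, LipschitzOnWith.of_dist_le_mul ?_⟩
  rintro ⟨t, x⟩ ⟨ht, hx⟩ ⟨s, y⟩ ⟨hs, hy⟩
  simp only [mem_closedBall_zero_iff] at hx hy
  simp only at ht hs
  have h1 : |valueFn F φ T t x - valueFn F φ T s x| ≤ L * C * |t - s| := by
    rcases le_total t s with hts | hts
    · rw [abs_sub_comm t s, abs_of_nonneg (sub_nonneg.2 hts)]
      exact htime t ht s hs hts x hx
    · rw [abs_sub_comm (valueFn _ _ _ _ _), abs_of_nonneg (sub_nonneg.2 hts)]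
      exact htime s hs t ht hts x hx
  have h2 : |valueFn F φ T s x - valueFn F φ T s y| ≤ L * ‖x - y‖ := by
    have i1 := hL s hs x y (hx.trans h.le) (hy.trans h.le)
    have i2 := hL s hs y x (hy.trans h.le) (hx.trans h.le)
    rw [norm_sub_rev] at i2
    rw [abs_le]; constructor <;> linarith
  have d1 : |t - s| ≤ dist (t, x) (s, y) := le_max_left _ _
  have d2 : ‖x - y‖ ≤ dist (t, x) (s, y) := by
    rw [← dist_eq_norm]; exact le_max_right _ _
  rw [Real.coe_toNNReal _ (by positivity), Real.dist_eq]
  have i3 : L * C * |t - s| ≤ L * C * dist (t, x) (s, y) := by gcongr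
  have i4 : L * ‖x - y‖ ≤ L * dist (t, x) (s, y) := by gcongr
  linarith [abs_sub_le (valueFn F φ T t x) (valueFn F φ T s x) (valueFn F φ T s y)]

theorem nonneg_of_forall_le_mul {a K : ℝ} (hK : 0 ≤ K) (h : ∀ ε > 0, -(K * ε) ≤ a) : 0 ≤ a := by
  by_contra! ha
  have h1 := h (-a / (2 * (K + 1))) (by apply div_pos <;> linarith)
  have h2 : K * (-a / (2 * (K + 1))) = -a / 2 * (K / (K + 1)) := by field_simp
  have h3 : K / (K + 1) ≤ 1 := by rw [div_le_one (by linarith)]; linarith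
  rw [h2] at h1
  nlinarith

theorem exists_small_step {p : ℝ × E → Prop} {t T C ε : ℝ} {x : E} (ht : t < T) (hC : 0 ≤ C)
    (hε : 0 < ε) (h : ∀ᶠ sy in 𝓝 (t, x), p sy) :
    ∃ δ > 0, δ ≤ ε ∧ t + δ ≤ T ∧ ∀ z, ‖z - x‖ ≤ C * δ → p (t + δ, z) := by
  obtain ⟨η, hη, hp⟩ := Metric.eventually_nhds_iff.1 h
  have hpos : 0 < η / (2 * (C + 1)) := by positivity
  refine ⟨min (η / (2 * (C + 1))) (min ε (T - t)), lt_min hpos (lt_min hε (by linarith)),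
    (min_le_right _ _).trans (min_le_left _ _), ?_, fun z hz => hp ?_⟩
  · linarith [(min_le_right (η / (2 * (C + 1))) _).trans (min_le_right ε (T - t))]
  · set δ := min (η / (2 * (C + 1))) (min ε (T - t)) with hδ
    have hδ0 : 0 < δ := lt_min hpos (lt_min hε (by linarith))
    have h1 : δ * (2 * (C + 1)) ≤ η := (le_div_iff₀ (by positivity)).1 (min_le_left _ _)
    rw [Prod.dist_eq, max_lt_iff]
    constructor
    · simp only [Real.dist_eq, add_sub_cancel_left, abs_of_pos hδ0]
      nlinarith
    · simp only [dist_eq_norm]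
      nlinarith

theorem StandingHyp.isViscositySolution_valueFn (hF : StandingHyp F) (hφ : Continuous φ) :
    IsViscositySolution F φ T (valueFn F φ T) := by
  refine ⟨valueFn_terminal F φ T, fun t ht x => ?_⟩
  obtain ⟨R, C, h⟩ := hF.exists_reachBounds T (norm_nonneg x)
  have hC := h.nonneg
  have hnorm : ∀ {δ : ℝ} {z : E}, 0 < δ → ‖z - x‖ ≤ C * δ →
      ‖((t + δ - t, z - x) : ℝ × E)‖ ≤ (1 + C) * δ := by
    intro δ z hδ hz
    rw [Prod.norm_def, max_le_iff]
    constructor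
    · simp only [add_sub_cancel_left, Real.norm_eq_abs, abs_of_pos hδ]
      nlinarith
    · simp only
      nlinarith
  constructor
  · intro q hq
    suffices Ham F x (-q.2) ≤ q.1 by linarith
    refine hF.ham_le fun v hv => ?_
    rw [inner_neg_right]
    suffices 0 ≤ q.1 + ⟪v, q.2⟫ by linarith
    refine nonneg_of_forall_le_mul (K := 1 + C + C * ‖q.2‖) (by positivity) fun ε hε => ?_
    obtain ⟨δ, hδ, hδε, hδT, hp⟩ := exists_small_step ht.2 hC hε (hq ε hε)
    have e1 : t + δ - t = δ := by ring
    have e2 : t + δ - t ≤ T := by linarith [ht.1]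
    obtain ⟨z, hz, hd⟩ := h.exists_velocity (by linarith) e2 le_rfl v hv
    have hzx := h.norm_sub_le (by linarith) e2 le_rfl hz
    rw [e1] at hzx hd
    have h1 := hp z hzx
    have h2 := hF.valueFn_le_of_reach hφ (by linarith) hδT hz
    have h3 := mul_le_mul_of_nonneg_left (hnorm hδ hzx) hε.le
    have h4 : ⟪q.2, z - x⟫ ≤ δ * ⟪v, q.2⟫ + ‖q.2‖ * (C * δ ^ 2) := by
      have : ⟪q.2, z - x⟫ = ⟪q.2, z - x - δ • v⟫ + δ * ⟪v, q.2⟫ := by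
        rw [inner_sub_right _ (z - x), inner_smul_right, real_inner_comm q.2 v]; ring
      rw [this]
      have := (real_inner_le_norm q.2 (z - x - δ • v)).trans
        (mul_le_mul_of_nonneg_left hd (norm_nonneg _))
      linarith
    simp only [e1] at h1 h3
    have h5 : 0 ≤ δ * (q.1 + ⟪v, q.2⟫ + ‖q.2‖ * C * δ + ε * (1 + C)) := by nlinarith
    have h6 := nonneg_of_mul_nonneg_right h5 hδ
    have h7 : ‖q.2‖ * C * δ ≤ ‖q.2‖ * C * ε := by gcongr
    nlinarith
  · intro q hq
    refine nonneg_of_forall_le_mul (K := 1 + C + 1 + C * ‖q.2‖) (by positivity) fun ε hε => ?_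
    obtain ⟨δ, hδ, hδε, hδT, hp⟩ := exists_small_step ht.2 hC hε (hq ε hε)
    have e1 : t + δ - t = δ := by ring
    have e2 : t + δ - t ≤ T := by linarith [ht.1]
    obtain ⟨z, hz, hlt⟩ := hF.exists_reach_valueFn_lt hφ (show t ≤ t + δ by linarith) hδT x
      (show 0 < δ ^ 2 by positivity)
    have hzx := h.norm_sub_le (by linarith) e2 le_rfl hz
    have hin := h.inner_le (by linarith) e2 le_rfl hz (-q.2)
    rw [e1] at hzx hin
    rw [inner_neg_right, real_inner_comm, norm_neg] at hin
    have h1 := hp z hzx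
    have h3 := mul_le_mul_of_nonneg_left (hnorm hδ hzx) hε.le
    simp only [e1] at h1 h3
    have h5 : 0 ≤ δ * (-q.1 + Ham F x (-q.2) + C * δ * ‖q.2‖ + δ + ε * (1 + C)) := by nlinarith
    have h6 := nonneg_of_mul_nonneg_right h5 hδ
    have h7 : C * δ * ‖q.2‖ ≤ C * ε * ‖q.2‖ := by gcongr
    nlinarith

end ValueFunction

/-- Doubling of variables: the maximum points of `f z - g z' - n * D z z'` over `K × K` cluster
at a maximum point of `f - g`, along which the penalization tends to zero. -/
theorem exists_doubling {Z : Type*} [MetricSpace Z] {K : Set Z} (hK : IsCompact K)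
    (hne : K.Nonempty) {f g : Z → ℝ} (hf : ContinuousOn f K) (hg : ContinuousOn g K)
    {D : Z → Z → ℝ} (hD : Continuous (fun p : Z × Z => D p.1 p.2)) (hD0 : ∀ z z', 0 ≤ D z z')
    (hDself : ∀ z, D z z = 0) (hDeq : ∀ z z', D z z' = 0 → z = z') :
    ∃ c ∈ K, (∀ z ∈ K, f z - g z ≤ f c - g c) ∧ ∀ ε > 0, ∃ n : ℝ, 0 ≤ n ∧
      ∃ z ∈ K, ∃ z' ∈ K, dist z c < ε ∧ dist z' c < ε ∧ n * D z z' < ε ∧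
        ∀ a ∈ K, ∀ b ∈ K, f a - g b - n * D a b ≤ f z - g z' - n * D z z' := by
  have hf1 : ContinuousOn (fun p : Z × Z => f p.1) (K ×ˢ K) :=
    hf.comp continuousOn_fst fun p hp => hp.1
  have hg1 : ContinuousOn (fun p : Z × Z => g p.2) (K ×ˢ K) :=
    hg.comp continuousOn_snd fun p hp => hp.2
  have hmax : ∀ n : ℕ, ∃ p ∈ K ×ˢ K, ∀ q ∈ K ×ˢ K,
      f q.1 - g q.2 - n * D q.1 q.2 ≤ f p.1 - g p.2 - n * D p.1 p.2 := fun n =>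
    (hK.prod hK).exists_isMaxOn (hne.prod hne)
      ((hf1.sub hg1).sub (continuousOn_const.mul hD.continuousOn))
  choose p hpK hp using hmax
  obtain ⟨c, hcK, σ, hσ, hlim⟩ := (hK.prod hK).tendsto_subseq hpK
  obtain ⟨B, hB⟩ := (hK.prod hK).bddAbove_image (hf1.sub hg1)
  have hBle : ∀ n, f (p n).1 - g (p n).2 ≤ B := fun n => hB ⟨p n, hpK n, rfl⟩
  have hdiag : ∀ n, ∀ z ∈ K, f z - g z ≤ f (p n).1 - g (p n).2 - n * D (p n).1 (p n).2 := by
    intro n z hz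
    have := hp n (z, z) ⟨hz, hz⟩
    simpa [hDself] using this
  obtain ⟨z₀, hz₀⟩ := hne
  have hσn : Tendsto (fun k => ((σ k : ℕ) : ℝ)) atTop atTop :=
    tendsto_natCast_atTop_atTop.comp hσ.tendsto_atTop
  have hDlim : Tendsto (fun k => D (p (σ k)).1 (p (σ k)).2) atTop (𝓝 (D c.1 c.2)) :=
    (hD.tendsto c).comp hlim
  have hDc : D c.1 c.2 = 0 := by
    by_contra hne0
    have hpos : 0 < D c.1 c.2 := lt_of_le_of_ne (hD0 _ _) (Ne.symm hne0)
    have h1 := hσn.atTop_mul_pos hpos hDlim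
    obtain ⟨k, hk⟩ := (h1.eventually_gt_atTop (B - (f z₀ - g z₀))).exists
    linarith [hdiag (σ k) z₀ hz₀, hBle (σ k)]
  have hc : c = (c.1, c.1) := Prod.ext rfl (hDeq _ _ hDc).symm
  have hin : ∀ᶠ k : ℕ in atTop, p (σ k) ∈ K ×ˢ K := .of_forall fun k => hpK _
  have hlim' := tendsto_nhdsWithin_iff.2 ⟨hlim, hin⟩
  have hflim : Tendsto (fun k => f (p (σ k)).1 - g (p (σ k)).2) atTop (𝓝 (f c.1 - g c.1)) := by
    have := ((hf1.sub hg1) c hcK).tendsto.comp hlim'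
    rw [hc] at this
    exact this
  refine ⟨c.1, hcK.1, fun z hz => ?_, fun ε hε => ?_⟩
  · refine ge_of_tendsto hflim (.of_forall fun k => ?_)
    have := mul_nonneg (Nat.cast_nonneg (α := ℝ) (σ k)) (hD0 (p (σ k)).1 (p (σ k)).2)
    linarith [hdiag (σ k) z hz]
  · have e1 : ∀ᶠ k in atTop, dist (p (σ k)).1 c.1 < ε :=
      (tendsto_iff_dist_tendsto_zero.1 ((continuous_fst.tendsto c).comp hlim)).eventually_lt_const hε
    have e2 : ∀ᶠ k in atTop, dist (p (σ k)).2 c.1 < ε := by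
      have := (continuous_snd.tendsto c).comp hlim
      rw [← hDeq _ _ hDc] at this
      exact (tendsto_iff_dist_tendsto_zero.1 this).eventually_lt_const hε
    have e3 : ∀ᶠ k in atTop, f (p (σ k)).1 - g (p (σ k)).2 < f c.1 - g c.1 + ε :=
      hflim.eventually_lt_const (lt_add_of_pos_right _ hε)
    obtain ⟨k, h1, h2, h3⟩ := (e1.and (e2.and e3)).exists
    refine ⟨σ k, Nat.cast_nonneg _, (p (σ k)).1, (hpK _).1, (p (σ k)).2, (hpK _).2, h1, h2, ?_,
      fun a ha b hb => hp (σ k) (a, b) ⟨ha, hb⟩⟩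
    linarith [hdiag (σ k) c.1 hcK.1]

theorem HasGradPair.eventually_abs_le {ψ : ℝ → E → ℝ} {t : ℝ} {x : E} {q : ℝ × E}
    (h : HasGradPair ψ t x q) {ε : ℝ} (hε : 0 < ε) : ∀ᶠ sy : ℝ × E in 𝓝 (t, x),
      |ψ sy.1 sy.2 - ψ t x - q.1 * (sy.1 - t) - ⟪q.2, sy.2 - x⟫| ≤
        ε * ‖((sy.1 - t, sy.2 - x) : ℝ × E)‖ := by
  have h1 := (hasFDerivAt_iff_isLittleO.1 h).def hε
  filter_upwards [h1] with sy hsy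
  rw [Real.norm_eq_abs] at hsy
  convert hsy using 2
  · simp [sub_sub, add_assoc]
  · rfl

theorem HasGradPair.mem_superPair {u ψ : ℝ → E → ℝ} {t : ℝ} {x : E} {q : ℝ × E}
    (h : HasGradPair ψ t x q)
    (hle : ∀ᶠ sy : ℝ × E in 𝓝 (t, x), u sy.1 sy.2 - u t x ≤ ψ sy.1 sy.2 - ψ t x) :
    q ∈ FSuperPair u t x := by
  intro ε hε
  filter_upwards [h.eventually_abs_le hε, hle] with sy h1 h2
  linarith [(abs_le.1 h1).2]

theorem HasGradPair.mem_subPair {u ψ : ℝ → E → ℝ} {t : ℝ} {x : E} {q : ℝ × E}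
    (h : HasGradPair ψ t x q)
    (hle : ∀ᶠ sy : ℝ × E in 𝓝 (t, x), ψ sy.1 sy.2 - ψ t x ≤ u sy.1 sy.2 - u t x) :
    q ∈ FSubPair u t x := by
  intro ε hε
  filter_upwards [h.eventually_abs_le hε, hle] with sy h1 h2
  linarith [(abs_le.1 h1).1]

theorem HasGradPair.add {ψ χ : ℝ → E → ℝ} {t : ℝ} {x : E} {p q : ℝ × E}
    (h : HasGradPair ψ t x p) (h' : HasGradPair χ t x q) :
    HasGradPair (fun s y => ψ s y + χ s y) t x (p + q) := by
  refine (HasFDerivAt.add h h').congr_fderiv ?_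
  ext <;> simp

theorem hasGradPair_of_hasDerivAt {f : ℝ → ℝ} {f' t : ℝ} (h : HasDerivAt f f' t) (x : E) :
    HasGradPair (fun s (_ : E) => f s) t x (f', 0) := by
  have := h.hasFDerivAt.comp (t, x) (hasFDerivAt_fst (𝕜 := ℝ) (E := ℝ) (F := E))
  refine this.congr_fderiv ?_
  ext <;> simp

theorem hasGradPair_dist_sq (n s t : ℝ) (x y : E) :
    HasGradPair (fun t x => n * ((t - s) ^ 2 + ‖x - y‖ ^ 2)) t x
      (2 * n * (t - s), (2 * n) • (x - y)) := by
  have h1 : HasFDerivAt (fun q : ℝ × E => (q.1 - s) ^ 2) _ (t, x) :=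
    ((hasFDerivAt_fst (𝕜 := ℝ) (E := ℝ) (F := E)).sub_const s).pow 2
  have h2 : HasFDerivAt (fun q : ℝ × E => ‖q.2 - y‖ ^ 2) _ (t, x) :=
    ((hasFDerivAt_snd (𝕜 := ℝ) (E := ℝ) (F := E)).sub_const y).norm_sq
  refine ((h1.add h2).const_mul n).congr_fderiv ?_
  ext <;> simp <;> ring

/-- A smooth barrier, decreasing along all trajectories of a map of sublinear growth, that is
small at a given point and large on the boundary of a ball. -/
theorem exists_barrier {F : E → Set E} {r : ℝ} (hr : 0 < r)
    (hgr : ∀ x, ∀ v ∈ F x, ‖v‖ ≤ r * (1 + ‖x‖)) {t₀ T : ℝ} (ht₀ : t₀ ≤ T) (x₀ : E) :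
    ∃ R, ‖x₀‖ ≤ R ∧ ∀ N d : ℝ, 0 < d → ∃ P : ℝ → E → ℝ, ∃ p : ℝ → E → ℝ × E,
      (∀ t x, HasGradPair P t x (p t x)) ∧ (∀ t x, 0 ≤ P t x) ∧ P t₀ x₀ = d ∧
      (∀ t ≤ T, ∀ x, ‖x‖ = R → N < P t x) ∧
      ∀ t x, ∀ v ∈ F x, (p t x).1 + ⟪v, (p t x).2⟫ ≤ 0 := by
  set k := 3 * r with hk
  set A := Real.exp (-(k * t₀)) * (1 + ‖x₀‖ ^ 2) with hA
  have hA0 : 0 < A := by positivity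
  let β : ℝ → E → ℝ := fun t x => Real.exp (-(k * t)) * (1 + ‖x‖ ^ 2) / A
  have hβ0 : ∀ t x, 0 < β t x := fun t x => by positivity
  have hβ : ∀ t x, HasGradPair β t x
      (-k * β t x, (2 * Real.exp (-(k * t)) / A) • x) := by
    intro t x
    have h1 : HasFDerivAt (fun q : ℝ × E => Real.exp (-(k * q.1))) _ (t, x) :=
      (((hasFDerivAt_fst (𝕜 := ℝ) (E := ℝ) (F := E)).const_mul k).neg).exp
    have h2 : HasFDerivAt (fun q : ℝ × E => 1 + ‖q.2‖ ^ 2) _ (t, x) :=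
      ((hasFDerivAt_snd (𝕜 := ℝ) (E := ℝ) (F := E)).norm_sq).const_add 1
    refine ((h1.mul h2).mul_const A⁻¹).congr_fderiv ?_
    ext <;> simp [β] <;> ring
  set R := Real.sqrt (2 * A * Real.exp (k * T)) with hR
  have hR2 : R ^ 2 = 2 * A * Real.exp (k * T) := Real.sq_sqrt (by positivity)
  refine ⟨R, ?_, fun N d hd => ?_⟩
  · apply Real.le_sqrt_of_sq_le
    have h1 : A * Real.exp (k * T) = Real.exp (k * (T - t₀)) * (1 + ‖x₀‖ ^ 2) := by
      rw [hA, mul_right_comm, ← Real.exp_add]; ring_nf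
    have h2 : 1 ≤ Real.exp (k * (T - t₀)) :=
      Real.one_le_exp (mul_nonneg (by positivity) (by linarith))
    nlinarith [sq_nonneg ‖x₀‖]
  · obtain ⟨m, hm⟩ := pow_unbounded_of_one_lt (N / d) (one_lt_two (α := ℝ))
    refine ⟨fun t x => d * β t x ^ m, fun t x => (d * (m * β t x ^ (m - 1))) •
      (-k * β t x, (2 * Real.exp (-(k * t)) / A) • x), fun t x => ?_, fun t x => ?_, ?_, ?_, ?_⟩
    · refine (((hβ t x).pow m).const_mul d).congr_fderiv ?_
      ext <;> simp <;> ring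
    · have := hβ0 t x
      positivity
    · have : β t₀ x₀ = 1 := div_self hA0.ne'
      simp [this]
    · intro t ht x hx
      have h2 : 2 ≤ β t x := by
        rw [le_div_iff₀ hA0, hx, hR2]
        have h3 : Real.exp (-(k * t)) * Real.exp (k * T) = Real.exp (k * (T - t)) := by
          rw [← Real.exp_add]; ring_nf
        have h4 : 1 ≤ Real.exp (k * (T - t)) :=
          Real.one_le_exp (mul_nonneg (by positivity) (by linarith))
        have h5 := Real.exp_pos (-(k * t))
        nlinarith
      have h3 : (2:ℝ) ^ m ≤ β t x ^ m := by gcongr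
      rw [div_lt_iff₀ hd] at hm
      nlinarith
    · intro t x v hv
      have h0 := hβ0 t x
      simp only [Prod.smul_fst, Prod.smul_snd, smul_eq_mul, inner_smul_right]
      rw [← mul_add]
      refine mul_nonpos_of_nonneg_of_nonpos (by positivity) ?_
      have h1 : ⟪v, x⟫ ≤ r * (1 + ‖x‖) * ‖x‖ :=
        (real_inner_le_norm _ _).trans (by gcongr; exact hgr x v hv)
      have h2 : -k * β t x + 2 * Real.exp (-(k * t)) / A * ⟪v, x⟫ =
          (Real.exp (-(k * t)) / A) * (2 * ⟪v, x⟫ - k * (1 + ‖x‖ ^ 2)) := by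
        simp only [β]; ring
      rw [h2]
      refine mul_nonpos_of_nonneg_of_nonpos (by positivity) ?_
      nlinarith [mul_nonneg hr.le (sq_nonneg (‖x‖ - 1))]

/-- Comparison principle: a subsolution lies below a supersolution if it does so at time `T`. -/
theorem StandingHyp.comparison [ProperSpace E] {F : E → Set E} (hF : StandingHyp F) {T : ℝ}
    {u w : ℝ → E → ℝ}
    (hu : ContinuousOn (fun q : ℝ × E => u q.1 q.2) (Icc 0 T ×ˢ univ))
    (hw : ContinuousOn (fun q : ℝ × E => w q.1 q.2) (Icc 0 T ×ˢ univ))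
    (hterm : ∀ x, u T x ≤ w T x)
    (hsub : ∀ t ∈ Ioo 0 T, ∀ x, ∀ q ∈ FSuperPair u t x, -q.1 + Ham F x (-q.2) ≤ 0)
    (hsuper : ∀ t ∈ Ioo 0 T, ∀ x, ∀ q ∈ FSubPair w t x, 0 ≤ -q.1 + Ham F x (-q.2)) :
    ∀ t ∈ Ioo 0 T, ∀ x, u t x ≤ w t x := by
  intro t₀ ht₀ x₀
  by_contra! hlt
  obtain ⟨ht₀0, ht₀T⟩ := ht₀
  have hT : 0 < T := ht₀0.trans ht₀T
  obtain ⟨r, hr, hgr⟩ := hF.2.2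
  obtain ⟨R, hxR, hR⟩ := exists_barrier hr hgr ht₀T.le x₀
  set d := u t₀ x₀ - w t₀ x₀ with hd
  have hd0 : 0 < d := by linarith
  have hK₀ : Icc (0:ℝ) T ×ˢ closedBall (0 : E) R ⊆ Icc 0 T ×ˢ univ :=
    prod_mono_right (subset_univ _)
  obtain ⟨N, hN⟩ := (isCompact_Icc.prod (isCompact_closedBall (0 : E) R)).bddAbove_image
    ((hu.sub hw).mono hK₀)
  have hN' : ∀ t x, 0 ≤ t → t ≤ T → ‖x‖ ≤ R → u t x - w t x ≤ N := fun t x h0 h1 h2 =>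
    hN ⟨(t, x), ⟨⟨h0, h1⟩, by simpa using h2⟩, rfl⟩
  have hN0 : 0 < N := hd0.trans_le (hN' t₀ x₀ ht₀0.le ht₀T.le hxR)
  obtain ⟨P, p, hPp, hP0, hPd, hPR, hPF⟩ := hR N (d / 4) (by linarith)
  obtain ⟨c, hc0, hc⟩ := hF.lipschitz_closedBall R
  set σ := t₀ * (d / 4) with hσ
  have hσ0 : 0 < σ := by positivity
  set τ := min t₀ (σ / (N + 1)) with hτ
  have hτ0 : 0 < τ := lt_min ht₀0 (by positivity)
  have hτσ : N < σ / τ := by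
    rw [lt_div_iff₀ hτ0]
    have h1 : τ * (N + 1) ≤ σ := (le_div_iff₀ (by linarith)).1 (min_le_right _ _)
    linarith
  set K := Icc τ T ×ˢ closedBall (0 : E) R with hK
  have hKsub : K ⊆ Icc 0 T ×ˢ univ := prod_mono (Icc_subset_Icc_left hτ0.le) (subset_univ _)
  have hKpos : ∀ z ∈ K, 0 < z.1 := fun z hz => hτ0.trans_le hz.1.1
  have hPc : Continuous fun q : ℝ × E => P q.1 q.2 :=
    continuous_iff_continuousAt.2 fun q => (hPp q.1 q.2).continuousAt
  have hz₀ : (t₀, x₀) ∈ K := ⟨⟨min_le_left _ _, ht₀T.le⟩, by simpa using hxR⟩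
  obtain ⟨m, hm, hmax, hdbl⟩ := exists_doubling (K := K)
    (f := fun q => u q.1 q.2 - P q.1 q.2 - σ / q.1) (g := fun q => w q.1 q.2)
    (D := fun z z' => (z.1 - z'.1) ^ 2 + ‖z.2 - z'.2‖ ^ 2)
    (isCompact_Icc.prod (isCompact_closedBall (0 : E) R)) ⟨_, hz₀⟩
    (((hu.mono hKsub).sub hPc.continuousOn).sub
      (continuousOn_const.div continuousOn_fst fun z hz => (hKpos z hz).ne'))
    (hw.mono hKsub) (by fun_prop) (fun _ _ => by positivity) (fun _ => by simp)
    (fun z z' h => by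
      have h1 := sq_nonneg (z.1 - z'.1)
      have h2 := sq_nonneg ‖z.2 - z'.2‖
      have h3 : (z.1 - z'.1) ^ 2 = 0 := by linarith
      have h4 : ‖z.2 - z'.2‖ ^ 2 = 0 := by linarith
      rw [sq_eq_zero_iff, sub_eq_zero] at h3
      rw [sq_eq_zero_iff, norm_eq_zero, sub_eq_zero] at h4
      exact Prod.ext h3 h4)
  have hval : d / 2 ≤ u m.1 m.2 - P m.1 m.2 - σ / m.1 - w m.1 m.2 := by
    have h1 := hmax _ hz₀
    have h2 : σ / t₀ = d / 4 := by rw [hσ]; field_simp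
    simp only [hPd, h2] at h1
    linarith
  have hmpos := hKpos _ hm
  have hσz : 0 < σ / m.1 := by positivity
  have hmR : ‖m.2‖ ≤ R := by simpa using hm.2
  have hmN := hN' m.1 m.2 hmpos.le hm.1.2 hmR
  have hPz := hP0 m.1 m.2
  have hτz : τ < m.1 := by
    refine lt_of_le_of_ne hm.1.1 fun h => ?_
    rw [h] at hτσ
    linarith
  have hzT : m.1 < T := by
    refine lt_of_le_of_ne hm.1.2 fun h => ?_
    have := hterm m.2
    rw [← h] at this
    linarith
  have hzR : ‖m.2‖ < R := by
    refine lt_of_le_of_ne hmR fun h => ?_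
    have := hPR m.1 hm.1.2 m.2 h
    linarith
  have hopen : IsOpen (Ioo τ T ×ˢ ball (0 : E) R) := isOpen_Ioo.prod isOpen_ball
  obtain ⟨η, hη, hball⟩ := Metric.isOpen_iff.1 hopen m ⟨⟨hτz, hzT⟩, by simpa using hzR⟩
  have hKint : Ioo τ T ×ˢ ball (0 : E) R ⊆ K := prod_mono Ioo_subset_Icc_self ball_subset_closedBall
  obtain ⟨n, hn, ⟨t, x⟩, hz, ⟨s, y⟩, hz', hzd, hz'd, hnD, hpen⟩ :=
    hdbl (min η (σ / T ^ 2 / (4 * c))) (by positivity)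
  replace hz := hball (hzd.trans_le (min_le_left _ _))
  replace hz' := hball (hz'd.trans_le (min_le_left _ _))
  have hzK := hKint hz
  have hzK' := hKint hz'
  replace hnD := hnD.trans_le (min_le_right _ _)
  dsimp only at hnD hpen
  have ht0 : 0 < t := hKpos _ hzK
  have hs0 : 0 < s := hKpos _ hzK'
  have htT : t < T := hz.1.2
  have hsT : s < T := hz'.1.2
  have hup : p t x + (-(σ / t ^ 2), 0) + (2 * n * (t - s), (2 * n) • (x - y)) ∈
      FSuperPair u t x := by
    have hσt : HasDerivAt (fun t => σ / t) (-(σ / t ^ 2)) t := by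
      simpa [div_eq_mul_inv] using (hasDerivAt_inv ht0.ne').const_mul σ
    refine (((hPp t x).add (hasGradPair_of_hasDerivAt hσt x)).add
      (hasGradPair_dist_sq n s t x y)).mem_superPair ?_
    filter_upwards [hopen.mem_nhds hz] with a ha
    have := hpen a (hKint ha) _ hzK'
    dsimp only at this
    linarith
  have hlow : (2 * -n * (s - t), (2 * -n) • (y - x)) ∈ FSubPair w s y := by
    refine (hasGradPair_dist_sq (-n) t s y x).mem_subPair ?_
    filter_upwards [hopen.mem_nhds hz'] with a ha
    have h1 := hpen _ hzK a (hKint ha)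
    dsimp only at h1
    rw [norm_sub_rev a.2, norm_sub_rev y]
    linarith
  have h1 := hsub t ⟨ht0, htT⟩ x _ hup
  have h2 := hsuper s ⟨hs0, hsT⟩ y _ hlow
  have hxR' : x ∈ closedBall (0 : E) R := hzK.2
  have hyR' : y ∈ closedBall (0 : E) R := hzK'.2
  have hham : Ham F y (-((2 * -n) • (y - x))) ≤
      Ham F x (-(p t x + (-(σ / t ^ 2), 0) + (2 * n * (t - s), (2 * n) • (x - y))).2) -
        (p t x).1 + 2 * c * (n * ‖x - y‖ ^ 2) := by
    refine hF.ham_le fun v' hv' => ?_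
    obtain ⟨v, hv, hvv⟩ := hc y hyR' x hxR' v' hv'
    have h3 := hF.inner_le_ham hv
      (-(p t x + (-(σ / t ^ 2), 0) + (2 * n * (t - s), (2 * n) • (x - y))).2)
    have h4 := hPF t x v hv
    have h5 : ⟪v' - v, y - x⟫ ≤ c * ‖x - y‖ ^ 2 := by
      refine (real_inner_le_norm _ _).trans ?_
      rw [norm_sub_rev x, pow_two, ← mul_assoc]
      gcongr
    have h6 := mul_le_mul_of_nonneg_left h5 hn
    simp only [Prod.snd_add, add_zero, inner_neg_right, inner_add_right, inner_smul_right,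
      inner_sub_right, inner_sub_left] at h3 h6 ⊢
    linarith
  have h7 : c * (n * ‖x - y‖ ^ 2) ≤ σ / T ^ 2 / 4 := by
    have h8 : n * ‖x - y‖ ^ 2 ≤ σ / T ^ 2 / (4 * c) := by
      have := mul_nonneg hn (sq_nonneg (t - s))
      linarith
    rw [le_div_iff₀ (by positivity)] at h8
    linarith
  have h9 : σ / T ^ 2 ≤ σ / t ^ 2 := by gcongr
  have h10 : 0 < σ / T ^ 2 := by positivity
  simp only [Prod.fst_add] at h1
  linarith

/-- Two solutions of the Hamilton–Jacobi equation that are continuous on `[0,T]` coincide. -/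
theorem StandingHyp.viscositySolution_unique [ProperSpace E] {F : E → Set E} (hF : StandingHyp F)
    {φ : E → ℝ} {T : ℝ} (hT : 0 < T) {u w : ℝ → E → ℝ}
    (hu : ContinuousOn (fun q : ℝ × E => u q.1 q.2) (Icc 0 T ×ˢ univ))
    (hw : ContinuousOn (fun q : ℝ × E => w q.1 q.2) (Icc 0 T ×ˢ univ))
    (hus : IsViscositySolution F φ T u) (hws : IsViscositySolution F φ T w)
    {t : ℝ} (ht : t ∈ Icc 0 T) (x : E) : u t x = w t x := by
  have hterm : ∀ x, u T x = w T x := fun x => (hus.1 x).trans (hws.1 x).symm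
  have hIoo : EqOn (fun t => u t x) (fun t => w t x) (Ioo 0 T) := fun t ht =>
    le_antisymm
      (hF.comparison hu hw (fun x => (hterm x).le) (fun t ht x => (hus.2 t ht x).1)
        (fun t ht x => (hws.2 t ht x).2) t ht x)
      (hF.comparison hw hu (fun x => (hterm x).ge) (fun t ht x => (hws.2 t ht x).1)
        (fun t ht x => (hus.2 t ht x).2) t ht x)
  have hslice : ContinuousOn (fun t : ℝ => (t, x)) (Icc 0 T) := by fun_prop
  have hmaps : MapsTo (fun t : ℝ => (t, x)) (Icc 0 T) (Icc 0 T ×ˢ univ) :=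
    fun t ht => ⟨ht, trivial⟩
  exact hIoo.of_subset_closure (hu.comp hslice hmaps) (hw.comp hslice hmaps) Ioo_subset_Icc_self
    (closure_Ioo hT.ne).ge ht

/-- The value function is Lipschitz continuous on unit balls. -/
theorem StandingHyp.valueFn_lipschitz_ball [ProperSpace E] {F : E → Set E} (hF : StandingHyp F)
    {φ : E → ℝ} (hφ : LocallyLipschitz φ) (T : ℝ) (q : ℝ × E) : ∃ L : ℝ≥0, LipschitzOnWith L
      (fun q : ℝ × E => valueFn F φ T q.1 q.2) (ball q 1 ∩ (Icc 0 T ×ˢ univ)) := by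
  obtain ⟨L, hL⟩ := hF.valueFn_lipschitz (T := T) hφ (ρ := ‖q.2‖ + 1) (by positivity)
  refine ⟨L, hL.mono fun z hz => ⟨hz.2.1, ?_⟩⟩
  have h1 : ‖z.2 - q.2‖ < 1 := (norm_snd_le (z - q)).trans_lt (mem_ball_iff_norm.1 hz.1)
  have h2 := norm_sub_norm_le z.2 q.2
  rw [mem_closedBall_zero_iff]
  linarith

theorem StandingHyp.continuousOn_valueFn [ProperSpace E] {F : E → Set E} (hF : StandingHyp F)
    {φ : E → ℝ} (hφ : LocallyLipschitz φ) (T : ℝ) :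
    ContinuousOn (fun q : ℝ × E => valueFn F φ T q.1 q.2) (Icc 0 T ×ˢ univ) := by
  intro q hq
  obtain ⟨L, hL⟩ := hF.valueFn_lipschitz_ball hφ T q
  refine (continuousWithinAt_inter' (mem_nhdsWithin_of_mem_nhds (ball_mem_nhds q one_pos))).1 ?_
  rw [inter_comm]
  exact hL.continuousOn q ⟨mem_ball_self one_pos, hq⟩

end Auxiliary

/-- Proposition 2.7.
Under (SH), with `φ` locally Lipschitz, the value function is locally Lipschitz on
`[0,T]×ℝⁿ` and is the unique viscosity solution of the Hamilton–Jacobi equation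
`−∂ₜu + H(x,−uₓ) = 0` in `(0,T)×ℝⁿ`, `u(T,·) = φ`. -/
theorem stmt17 {n : ℕ} (F : Euc n → Set (Euc n)) (φ : Euc n → ℝ) (T : ℝ)
    (hSH : StandingHyp F) (hφ : LocallyLipschitz φ) (hT : 0 < T) :
    (∀ q ∈ (Icc (0:ℝ) T ×ˢ (univ : Set (Euc n))), ∃ ε > (0:ℝ), ∃ L : ℝ≥0,
      LipschitzOnWith L (fun q : ℝ × Euc n => valueFn F φ T q.1 q.2)
        (ball q ε ∩ (Icc (0:ℝ) T ×ˢ (univ : Set (Euc n))))) ∧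
    IsViscositySolution F φ T (valueFn F φ T) ∧
    (∀ u : ℝ → Euc n → ℝ,
      ContinuousOn (fun q : ℝ × Euc n => u q.1 q.2)
        (Icc (0:ℝ) T ×ˢ (univ : Set (Euc n))) →
      IsViscositySolution F φ T u →
      ∀ t ∈ Icc (0:ℝ) T, ∀ x : Euc n, u t x = valueFn F φ T t x) := by
  have hV := hSH.isViscositySolution_valueFn (T := T) hφ.continuous
  exact ⟨fun q _ => ⟨1, one_pos, hSH.valueFn_lipschitz_ball hφ T q⟩, hV, fun u hu hus t ht x =>
    hSH.viscositySolution_unique hT hu (hSH.continuousOn_valueFn hφ T) hus hV ht x⟩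

end
end

section
/- Let F satisfy (SH) and let K ⊂ ℝⁿ be convex. For p ∈ ℝⁿ and c ≥ 0, the map x ↦ H(x,p) is semiconvex on K with semiconvexity constant c|p| for every p if and only if F has the mid-point property on K: dist⁺_H(2F(x), F(x+z)+F(x−z)) ≤ c|z|² for all x,z such that x, x±z ∈ K, where dist⁺_H is the Hausdorff semidistance and 2F(x), F(x+z)+F(x−z) are Minkowski scaling and sum. -/
open MeasureTheory Filter Metric Set Topology
open scoped RealInnerProductSpace ENNReal NNReal Pointwise

noncomputable section

variable {E : Type*} [NormedAddCommGroup E] [InnerProductSpace ℝ E] [CompleteSpace E]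

theorem inner_le_Ham {V : Type*} [NormedAddCommGroup V] [InnerProductSpace ℝ V]
    {F : V → Set V} {x : V} (hF : IsCompact (F x)) (p : V) {v : V} (hv : v ∈ F x) :
    ⟪v, p⟫ ≤ Ham F x p :=
  le_csSup (hF.image (by fun_prop : Continuous fun v : V => ⟪v, p⟫)).bddAbove ⟨v, hv, rfl⟩

theorem exists_mem_inner_eq_Ham {V : Type*} [NormedAddCommGroup V] [InnerProductSpace ℝ V]
    {F : V → Set V} {x : V} (hF : IsCompact (F x)) (hne : (F x).Nonempty) (p : V) :
    ∃ v ∈ F x, ⟪v, p⟫ = Ham F x p :=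
  (hF.image (by fun_prop : Continuous fun v : V => ⟪v, p⟫)).sSup_mem (hne.image _)

/-- The metric projection onto a nonempty compact convex set, with its variational inequality. -/
theorem exists_proj_of_isCompact_convex {V : Type*} [NormedAddCommGroup V]
    [InnerProductSpace ℝ V] {A : Set V} (hne : A.Nonempty) (hA : IsCompact A)
    (hconv : Convex ℝ A) (w : V) : ∃ a ∈ A, ∀ b ∈ A, ⟪w - a, b - a⟫ ≤ 0 := by
  obtain ⟨a, ha, h⟩ := exists_norm_eq_iInf_of_complete_convex hne hA.isComplete hconv w
  exact ⟨a, ha, (norm_eq_iInf_iff_real_inner_le_zero hconv ha).1 h⟩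

/-- the semiconvexity of `H(·,p)` with constant `c|p|` is equivalent to
the mid-point property of `F`: for `K` convex and `c ≥ 0`,
`x ↦ H(x,p)` is semiconvex on `K` with constant `c|p|` for every `p` iff
`dist⁺_H(2F(x), F(x+z)+F(x−z)) ≤ c|z|²` for all `x,z` with `x, x±z ∈ K`. -/
theorem stmt18 {n : ℕ} (F : Euc n → Set (Euc n))
    (hSH : StandingHyp F) (K : Set (Euc n)) (hK : Convex ℝ K) (c : ℝ) (hc : 0 ≤ c) :
    (∀ p : Euc n, SemiconvexWith (fun x => Ham F x p) K (c * ‖p‖)) ↔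
    (∀ x z : Euc n, x ∈ K → x + z ∈ K → x - z ∈ K →
      ∀ w ∈ (2:ℝ) • F x,
        EMetric.infEdist w (F (x + z) + F (x - z)) ≤ ENNReal.ofReal (c * ‖z‖ ^ 2)) := by
  obtain ⟨hF, -, -⟩ := hSH
  have hcpt : ∀ x, IsCompact (F x) := fun x => (hF x).2.2
  constructor
  · rintro h x z - hxp hxm _ ⟨v, hv, rfl⟩
    obtain ⟨a, ha, hproj⟩ := exists_proj_of_isCompact_convex
      ((hF (x + z)).1.add (hF (x - z)).1) ((hcpt (x + z)).add (hcpt (x - z)))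
      ((hF (x + z)).2.1.add (hF (x - z)).2.1) ((2 : ℝ) • v)
    set p := (2 : ℝ) • v - a with hp
    obtain ⟨v₁, hv₁, h₁⟩ := exists_mem_inner_eq_Ham (hcpt (x + z)) (hF _).1 p
    obtain ⟨v₂, hv₂, h₂⟩ := exists_mem_inner_eq_Ham (hcpt (x - z)) (hF _).1 p
    have hle := hproj _ (add_mem_add hv₁ hv₂)
    have hv_le := inner_le_Ham (hcpt x) p hv
    have hsc : -(c * ‖p‖ * ‖z‖ ^ 2) ≤ Ham F (x + z) p + Ham F (x - z) p - 2 * Ham F x p :=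
      h p x z hxp hxm
    have hsq : ‖p‖ * ‖p‖ = 2 * ⟪v, p⟫ - ⟪a, p⟫ := by
      rw [← real_inner_self_eq_norm_mul_norm]
      nth_rewrite 1 [hp]
      rw [inner_sub_left, real_inner_smul_left]
    rw [real_inner_comm, inner_sub_left, inner_add_left] at hle
    have hmul : ‖p‖ * ‖p‖ ≤ ‖p‖ * (c * ‖z‖ ^ 2) := by linarith
    have hnorm : ‖p‖ ≤ c * ‖z‖ ^ 2 := by
      rcases (norm_nonneg p).eq_or_lt with h0 | h0
      · rw [← h0]; positivity
      · exact le_of_mul_le_mul_left hmul h0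
    refine (infEDist_le_edist_of_mem ha).trans ?_
    rw [edist_dist, dist_eq_norm]
    exact ENNReal.ofReal_le_ofReal hnorm
  · intro h p x z hxp hxm
    have hx : x ∈ K := by
      have := hK hxp hxm (by norm_num : (0 : ℝ) ≤ 1 / 2) (by norm_num : (0 : ℝ) ≤ 1 / 2)
        (by norm_num)
      convert this using 1
      module
    obtain ⟨v, hv, hvH⟩ := exists_mem_inner_eq_Ham (hcpt x) (hF x).1 p
    have hd := h x z hx hxp hxm _ (smul_mem_smul_set hv)
    obtain ⟨_, ⟨a₁, ha₁, a₂, ha₂, rfl⟩, hdist⟩ :=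
      ((hcpt (x + z)).add (hcpt (x - z))).exists_infEDist_eq_edist
        ((hF (x + z)).1.add (hF (x - z)).1) ((2 : ℝ) • v)
    have hnorm : ‖(2 : ℝ) • v - (a₁ + a₂)‖ ≤ c * ‖z‖ ^ 2 := by
      rw [← dist_eq_norm, ← ENNReal.ofReal_le_ofReal_iff (by positivity), ← edist_dist]
      exact hdist.ge.trans hd
    have hcs := real_inner_le_norm ((2 : ℝ) • v - (a₁ + a₂)) p
    have hb := mul_le_mul_of_nonneg_right hnorm (norm_nonneg p)
    rw [inner_sub_left, real_inner_smul_left, inner_add_left] at hcs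
    have h₁ := inner_le_Ham (hcpt (x + z)) p ha₁
    have h₂ := inner_le_Ham (hcpt (x - z)) p ha₂
    change -(c * ‖p‖ * ‖z‖ ^ 2) ≤ Ham F (x + z) p + Ham F (x - z) p - 2 * Ham F x p
    linarith

end
end

section
/- Let n = 1 and let F(x) = [f(x), g(x)] where f,g:ℝ→ℝ satisfy f ≤ g, −f and g are locally semiconvex (so that (SH) and (H1) hold). If the value function V is differentiable at a point (t₀,x₀) ∈ [0,T)×ℝ with V_x(t₀,x₀) ≠ 0, then there exists a unique optimal trajectory for the Mayer problem P(t₀,x₀) starting from (t₀,x₀); namely, the unique solution of x'(t) = f(x(t)) if V_x(t₀,x₀) > 0, and of x'(t) = g(x(t)) if V_x(t₀,x₀) < 0, with x(t₀) = x₀. -/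
open MeasureTheory Filter Metric Set Topology
open scoped RealInnerProductSpace ENNReal NNReal Pointwise

noncomputable section

variable {E : Type*} [NormedAddCommGroup E] [InnerProductSpace ℝ E] [CompleteSpace E]

section Arcs

variable {a b c d : ℝ} {x x' y y' : ℝ → E}

omit [CompleteSpace E] in
lemma ACArc.continuousOn (h : ACArc a b x x') (hab : a ≤ b) : ContinuousOn x (Icc a b) := by
  have h1 := intervalIntegral.continuousOn_primitive_interval' h.1 left_mem_uIcc
  rw [uIcc_of_le hab] at h1
  exact (continuousOn_const.add h1).congr h.2.1

omit [CompleteSpace E] in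
lemma ACArc.intervalIntegrable (h : ACArc a b x x') (hc : c ∈ Icc a b) (hd : d ∈ Icc a b) :
    IntervalIntegrable x' volume c d := by
  refine h.1.mono_set ?_
  rw [uIcc_of_le (hc.1.trans hc.2)]
  exact uIcc_subset_Icc hc hd

omit [CompleteSpace E] in
lemma ACArc.eq_add_integral (h : ACArc a b x x') (hc : c ∈ Icc a b) (hd : d ∈ Icc a b) :
    x d = x c + ∫ r in c..d, x' r := by
  have ha : a ∈ Icc a b := ⟨le_rfl, hc.1.trans hc.2⟩
  rw [h.2.1 d hd, h.2.1 c hc, add_assoc, intervalIntegral.integral_add_adjacent_intervals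
    (h.intervalIntegrable ha hc) (h.intervalIntegrable hc hd)]

omit [CompleteSpace E] in
lemma ACArc.mono (h : ACArc a b x x') (hc : c ∈ Icc a b) (hd : d ∈ Icc a b) :
    ACArc c d x x' := by
  have hsub : Icc c d ⊆ Icc a b := Icc_subset_Icc hc.1 hd.2
  refine ⟨h.intervalIntegrable hc hd, fun s hs => h.eq_add_integral hc (hsub hs), ?_⟩
  filter_upwards [h.2.2] with s hs hsc using hs (hsub hsc)

omit [CompleteSpace E] in
lemma IsTraj.mono {F : E → Set E} (h : IsTraj F a b x x') (hc : c ∈ Icc a b)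
    (hd : d ∈ Icc a b) : IsTraj F c d x x' := by
  refine ⟨h.1.mono hc hd, ?_⟩
  filter_upwards [h.2] with s hs hsc using hs (Icc_subset_Icc hc.1 hd.2 hsc)

omit [CompleteSpace E] in
/-- Two trajectories that meet at time `c` can be concatenated there. -/
lemma IsTraj.concat {F : E → Set E} (hx : IsTraj F a c x x') (hy : IsTraj F c b y y')
    (hac : a ≤ c) (hcb : c ≤ b) (hxy : x c = y c) :
    IsTraj F a b (fun s => if s ≤ c then x s else y s) (fun s => if s ≤ c then x' s else y' s) := by
  have hL : ∀ s ∈ Icc a c, EqOn x' (fun s => if s ≤ c then x' s else y' s) (uIoc a s) := by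
    intro s hs r hr
    rw [uIoc_of_le hs.1] at hr
    exact (if_pos (hr.2.trans hs.2)).symm
  have hR : ∀ s ∈ Icc c b, EqOn y' (fun s => if s ≤ c then x' s else y' s) (uIoc c s) := by
    intro s hs r hr
    rw [uIoc_of_le hs.1] at hr
    exact (if_neg hr.1.not_ge).symm
  have hLi : ∀ s ∈ Icc a c, ∫ r in a..s, x' r = ∫ r in a..s, if r ≤ c then x' r else y' r :=
    fun s hs => intervalIntegral.integral_congr_ae (Eventually.of_forall (hL s hs))
  have hRi : ∀ s ∈ Icc c b, ∫ r in c..s, y' r = ∫ r in c..s, if r ≤ c then x' r else y' r :=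
    fun s hs => intervalIntegral.integral_congr_ae (Eventually.of_forall (hR s hs))
  have hcL : c ∈ Icc a c := ⟨hac, le_rfl⟩
  have hbR : b ∈ Icc c b := ⟨hcb, le_rfl⟩
  have hcR : c ∈ Icc c b := ⟨le_rfl, hcb⟩
  have haL : a ∈ Icc a c := ⟨le_rfl, hac⟩
  have hiL : IntervalIntegrable (fun s => if s ≤ c then x' s else y' s) volume a c :=
    hx.1.1.congr (hL c hcL)
  have hiR : ∀ s ∈ Icc c b,
      IntervalIntegrable (fun s => if s ≤ c then x' s else y' s) volume c s :=
    fun s hs => (hy.1.intervalIntegrable hcR hs).congr (hR s hs)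
  refine ⟨⟨hiL.trans (hiR b hbR), fun s hs => ?_, ?_⟩, ?_⟩
  · simp only [if_pos hac]
    by_cases hsc : s ≤ c
    · rw [if_pos hsc, ← hLi s ⟨hs.1, hsc⟩]
      exact hx.1.2.1 s ⟨hs.1, hsc⟩
    · have hsR : s ∈ Icc c b := ⟨(not_le.1 hsc).le, hs.2⟩
      rw [if_neg hsc, ← intervalIntegral.integral_add_adjacent_intervals hiL (hiR s hsR),
        ← hLi c hcL,
        ← hRi s hsR, ← add_assoc, ← hx.1.2.1 c hcL, hxy]
      exact hy.1.2.1 s hsR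
  · filter_upwards [hx.1.2.2, hy.1.2.2, measure_eq_zero_iff_ae_notMem.1 (measure_singleton c)]
      with s h1 h2 hne hs
    rcases lt_or_gt_of_ne hne with h | h
    · rw [if_pos h.le]
      refine (h1 ⟨hs.1, h.le⟩).congr_of_eventuallyEq ?_
      filter_upwards [Iio_mem_nhds h] with r hr using if_pos (le_of_lt hr)
    · rw [if_neg h.not_ge]
      refine (h2 ⟨h.le, hs.2⟩).congr_of_eventuallyEq ?_
      filter_upwards [Ioi_mem_nhds h] with r hr using if_neg (not_le.2 hr)
  · filter_upwards [hx.2, hy.2] with s h1 h2 hs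
    by_cases h : s ≤ c
    · simpa only [if_pos h] using h1 ⟨hs.1, h⟩
    · simpa only [if_neg h] using h2 ⟨(not_le.1 h).le, hs.2⟩

omit [CompleteSpace E] in
lemma ACArc.neg (h : ACArc a b x x') : ACArc a b (-x) (-x') := by
  refine ⟨h.1.neg, fun s hs => ?_, ?_⟩
  · simp only [Pi.neg_apply, intervalIntegral.integral_neg]
    rw [h.2.1 s hs, neg_add]
  · filter_upwards [h.2.2] with s hs hsc using (hs hsc).neg

/-- Classical solutions of an autonomous equation are absolutely continuous arcs. -/
lemma acArc_of_hasDerivAt {f : E → E} (hf : Continuous f) (hab : a ≤ b)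
    (hx : ∀ s ∈ Icc a b, HasDerivAt x (f (x s)) s) : ACArc a b x (fun s => f (x s)) := by
  have hc : ContinuousOn (fun s => f (x s)) (Icc a b) :=
    hf.comp_continuousOn (HasDerivAt.continuousOn hx)
  have hi : ∀ s ∈ Icc a b, IntervalIntegrable (fun s => f (x s)) volume a s := fun s hs =>
    (hc.mono (uIcc_subset_Icc ⟨le_rfl, hab⟩ hs)).intervalIntegrable
  refine ⟨hi b ⟨hab, le_rfl⟩, fun s hs => ?_, Eventually.of_forall hx⟩
  rw [intervalIntegral.integral_eq_sub_of_hasDerivAt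
    (fun r hr => hx r (uIcc_subset_Icc ⟨le_rfl, hab⟩ hs hr)) (hi s hs), add_sub_cancel]

end Arcs

lemma LocallyLipschitz.exists_lipschitzOnWith {α β : Type*} [PseudoMetricSpace α]
    [PseudoMetricSpace β] {f : α → β} (hf : LocallyLipschitz f) {s : Set α} (hs : IsCompact s) :
    ∃ K, LipschitzOnWith K f s :=
  hf.locallyLipschitzOn.exists_lipschitzOnWith_of_compact hs

/-- Comparison of absolutely continuous sub- and supersolutions of a scalar equation. -/
lemma ACArc.le_of_subsolution {f : ℝ → ℝ} (hf : LocallyLipschitz f) {a b : ℝ}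
    {x x' y y' : ℝ → ℝ} (hx : ACArc a b x x') (hy : ACArc a b y y')
    (hxf : ∀ᵐ s ∂volume, s ∈ Icc a b → x' s ≤ f (x s))
    (hyf : ∀ᵐ s ∂volume, s ∈ Icc a b → f (y s) ≤ y' s) (h0 : x a ≤ y a) :
    ∀ s ∈ Icc a b, x s ≤ y s := by
  intro s hs
  by_contra! hlt
  have hab : a ≤ b := hs.1.trans hs.2
  have hxc := hx.continuousOn hab
  have hyc := hy.continuousOn hab
  obtain ⟨K, hK⟩ := hf.exists_lipschitzOnWith
    ((isCompact_Icc.image_of_continuousOn hxc).union (isCompact_Icc.image_of_continuousOn hyc))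
  have hsub : Icc a s ⊆ Icc a b := Icc_subset_Icc_right hs.2
  have hcl : IsCompact {r ∈ Icc a s | x r ≤ y r} := by
    refine isCompact_Icc.of_isClosed_subset ?_ (fun r hr => hr.1)
    exact isClosed_Icc.isClosed_le (hxc.mono hsub) (hyc.mono hsub)
  obtain ⟨τ, ⟨hτ, hτle⟩, hτmax⟩ := hcl.exists_isGreatest ⟨a, ⟨le_rfl, hs.1⟩, h0⟩
  have hτs : τ < s := lt_of_le_of_ne hτ.2 (by rintro rfl; exact hlt.not_ge hτle)
  have hpos : ∀ r ∈ Ioc τ s, y r < x r := by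
    intro r hr
    by_contra! h
    exact hr.1.not_ge (hτmax ⟨⟨hτ.1.trans hr.1.le, hr.2⟩, h⟩)
  have hK1 : (0:ℝ) < 2 * K + 1 := by positivity
  obtain ⟨ρ, hρτ, hρs, hρK⟩ : ∃ ρ, τ < ρ ∧ ρ ≤ s ∧ K * (ρ - τ) ≤ 1 / 2 := by
    refine ⟨min s (τ + 1 / (2 * K + 1)), lt_min hτs (by linarith [one_div_pos.2 hK1]),
      min_le_left _ _, ?_⟩
    calc (K:ℝ) * (min s (τ + 1 / (2 * K + 1)) - τ) ≤ K * (1 / (2 * K + 1)) := by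
          gcongr
          linarith [min_le_right s (τ + 1 / (2 * K + 1))]
      _ ≤ 1 / 2 := by
          rw [mul_one_div, div_le_div_iff₀ hK1 two_pos]
          linarith
  have hsubρ : Icc τ ρ ⊆ Icc a b := fun r hr => ⟨hτ.1.trans hr.1, hr.2.trans (hρs.trans hs.2)⟩
  obtain ⟨m, hm, hmax⟩ := isCompact_Icc.exists_isMaxOn (nonempty_Icc.2 hρτ.le)
    ((hxc.sub hyc).mono hsubρ)
  have hm' : ∀ r ∈ Icc τ ρ, x r - y r ≤ x m - y m := fun r hr => hmax hr
  have hmpos : 0 < x m - y m :=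
    (sub_pos.2 (hpos ρ ⟨hρτ, hρs⟩)).trans_le (hm' ρ ⟨hρτ.le, le_rfl⟩)
  have hτab : τ ∈ Icc a b := hsub hτ
  have hix := hx.intervalIntegrable hτab (hsubρ hm)
  have hiy := hy.intervalIntegrable hτab (hsubρ hm)
  have hint : x m - y m ≤ (x τ - y τ) + ∫ r in τ..m, (x' r - y' r) := by
    rw [intervalIntegral.integral_sub hix hiy, hx.eq_add_integral hτab (hsubρ hm),
      hy.eq_add_integral hτab (hsubρ hm)]
    linarith
  have hbd : ∫ r in τ..m, (x' r - y' r) ≤ ∫ _ in τ..m, K * (x m - y m) := by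
    refine intervalIntegral.integral_mono_ae_restrict hm.1 (hix.sub hiy) (by simp) ?_
    rw [EventuallyLE, ae_restrict_iff' measurableSet_Icc]
    filter_upwards [hxf, hyf, measure_eq_zero_iff_ae_notMem.1 (measure_singleton τ)]
      with r h1 h2 hne hr
    have hrρ : r ∈ Icc τ ρ := ⟨hr.1, hr.2.trans hm.2⟩
    have hr' := hsubρ hrρ
    have h3 := hK.dist_le_mul _ (Or.inl ⟨r, hr', rfl⟩) _ (Or.inr ⟨r, hr', rfl⟩)
    rw [Real.dist_eq, Real.dist_eq, abs_of_pos
      (sub_pos.2 (hpos r ⟨lt_of_le_of_ne hr.1 (Ne.symm hne), hrρ.2.trans hρs⟩))] at h3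
    calc x' r - y' r ≤ f (x r) - f (y r) := sub_le_sub (h1 hr') (h2 hr')
      _ ≤ K * (x r - y r) := (le_abs_self _).trans h3
      _ ≤ K * (x m - y m) := by exact mul_le_mul_of_nonneg_left (hm' r hrρ) K.2
  rw [intervalIntegral.integral_const, smul_eq_mul] at hbd
  have hmρ : K * (m - τ) ≤ 1 / 2 := le_trans (by gcongr; exact hm.2) hρK
  nlinarith [mul_le_mul_of_nonneg_right hmρ hmpos.le]

/-- A locally Lipschitz scalar field of at most linear growth has solutions on all of `[a,b]`. -/
lemma exists_solution_of_linear_growth {f : ℝ → ℝ} (hf : LocallyLipschitz f) {r : ℝ} (hr : 0 ≤ r)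
    (hfr : ∀ x, |f x| ≤ r * (1 + |x|)) {a b : ℝ} (hab : a ≤ b) (x₀ : ℝ) :
    ∃ x : ℝ → ℝ, x a = x₀ ∧ ∀ s ∈ Icc a b, HasDerivAt x (f (x s)) s := by
  set R := gronwallBound |x₀| r r (b - a) with hR
  have hmono := gronwallBound_mono (abs_nonneg x₀) hr hr
  have hR0 : 0 ≤ R := by
    have := hmono (sub_nonneg.2 hab)
    rw [gronwallBound_x0] at this
    exact (abs_nonneg x₀).trans this
  have hRR : -R ≤ R := by linarith
  obtain ⟨K, hK⟩ := hf.exists_lipschitzOnWith (isCompact_Icc (a := -R) (b := R))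
  set F : ℝ → ℝ := fun x => f (projIcc (-R) R hRR x) with hF
  have hFlip : LipschitzWith K F := by
    have h1 : LipschitzWith K ((Icc (-R) R).domRestrict f) := hK.to_restrict
    have h2 := h1.comp (LipschitzWith.projIcc hRR)
    rwa [mul_one] at h2
  have hproj : ∀ x : ℝ, |(projIcc (-R) R hRR x : ℝ)| ≤ |x| := by
    intro x
    have h := (LipschitzWith.projIcc hRR).dist_le_mul x 0
    have h0 : (0:ℝ) ∈ Icc (-R) R := ⟨by linarith, hR0⟩
    rw [projIcc_of_mem hRR h0, Subtype.dist_eq] at h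
    simpa [Real.dist_eq] using h
  have hFr : ∀ x, |F x| ≤ r * |x| + r := fun x => by
    calc |F x| ≤ r * (1 + |(projIcc (-R) R hRR x : ℝ)|) := hfr _
      _ ≤ r * (1 + |x|) := mul_le_mul_of_nonneg_left (add_le_add_right (hproj x) 1) hr
      _ = r * |x| + r := by ring
  have hFL : ∀ x, |F x| ≤ r * (1 + R) := fun x => by
    refine (hfr _).trans ?_
    gcongr
    exact abs_le.2 (projIcc (-R) R hRR x).2
  have hL0 : 0 ≤ r * (1 + R) := by positivity
  have hA0 : 0 ≤ r * (1 + R) * (b - a + 1) := mul_nonneg hL0 (by linarith)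
  have hPL : IsPicardLindelof (fun _ => F) (tmin := a - 1) (tmax := b + 1)
      ⟨a, by linarith, by linarith⟩ x₀ (NNReal.mk _ hA0) 0 (NNReal.mk _ hL0) K := by
    refine ⟨fun _ _ => hFlip.lipschitzOnWith, fun _ _ => continuousOn_const,
      fun _ _ x _ => hFL x, ?_⟩
    simp only [NNReal.coe_mk, NNReal.coe_zero, sub_zero]
    exact mul_le_mul_of_nonneg_left (max_le (by linarith) (by linarith)) hL0
  obtain ⟨x, hx0, hx⟩ := hPL.exists_eq_forall_mem_Icc_hasDerivWithinAt₀
  have hxd : ∀ s ∈ Icc a b, HasDerivAt x (F (x s)) s := fun s hs =>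
    (hx s ⟨by linarith [hs.1], by linarith [hs.2]⟩).hasDerivAt
      (Icc_mem_nhds (by linarith [hs.1]) (by linarith [hs.2]))
  refine ⟨x, hx0, fun s hs => ?_⟩
  have hxs : |x s| ≤ R := by
    refine (norm_le_gronwallBound_of_norm_deriv_right_le (HasDerivAt.continuousOn hxd)
      (fun t ht => (hxd t (Ico_subset_Icc_self ht)).hasDerivWithinAt) (le_of_eq ?_)
      (fun t _ => hFr (x t)) s hs).trans (hmono (by linarith [hs.2]))
    rw [← Real.norm_eq_abs]
    exact congrArg _ hx0
  have := hxd s hs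
  simp only [hF] at this
  rwa [projIcc_of_mem hRR (abs_le.1 hxs)] at this

section Interval

variable {f g : ℝ → ℝ} {y y' : ℝ → ℝ} {F : ℝ → Set ℝ} {φ : ℝ → ℝ} {r a b x₀ : ℝ}

/-- Solutions of `x' = h(x)` for a continuous selection `h` of `F` are trajectories of `F`. -/
lemma isTraj_of_selection {h : ℝ → ℝ} (hh : Continuous h) (hhF : ∀ x, h x ∈ F x) (hab : a ≤ b)
    (hy : ∀ s ∈ Icc a b, HasDerivAt y (h (y s)) s) : IsTraj F a b y (fun s => h (y s)) :=
  ⟨acArc_of_hasDerivAt hh hab hy, Eventually.of_forall fun s _ => hhF (y s)⟩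

/-- Trajectories dominate solutions of the equation of the lower endpoint. -/
lemma IsTraj.lower_le (hf : LocallyLipschitz f) (hF : ∀ x, F x ⊆ Ici (f x))
    (hy : IsTraj F a b y y') {w : ℝ → ℝ} (hw : ∀ s ∈ Icc a b, HasDerivAt w (f (w s)) s)
    (h0 : w a ≤ y a) : ∀ s ∈ Icc a b, w s ≤ y s := by
  intro s hs
  refine (acArc_of_hasDerivAt hf.continuous (hs.1.trans hs.2) hw).le_of_subsolution hf hy.1
    (Eventually.of_forall fun _ _ => le_rfl) ?_ h0 s hs
  filter_upwards [hy.2] with r hr hrs using hF _ (hr hrs)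

/-- Trajectories are dominated by solutions of the equation of the upper endpoint. -/
lemma IsTraj.le_upper (hg : LocallyLipschitz g) (hF : ∀ x, F x ⊆ Iic (g x))
    (hy : IsTraj F a b y y') {z : ℝ → ℝ} (hz : ∀ s ∈ Icc a b, HasDerivAt z (g (z s)) s)
    (h0 : y a ≤ z a) : ∀ s ∈ Icc a b, y s ≤ z s := by
  intro s hs
  refine hy.1.le_of_subsolution hg (acArc_of_hasDerivAt hg.continuous (hs.1.trans hs.2) hz)
    ?_ (Eventually.of_forall fun _ _ => le_rfl) h0 s hs
  filter_upwards [hy.2] with r hr hrs using hF _ (hr hrs)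

/-- A trajectory ending at the endpoint of the lower solution with the same initial value
coincides with it. -/
lemma IsTraj.eq_lower (hf : LocallyLipschitz f) (hr : 0 ≤ r) (hfr : ∀ x, |f x| ≤ r * (1 + |x|))
    (hF : ∀ x, F x ⊆ Ici (f x)) (hy : IsTraj F a b y y') {w : ℝ → ℝ}
    (hw : ∀ s ∈ Icc a b, HasDerivAt w (f (w s)) s) (h0 : y a = w a) (hb : y b = w b) :
    ∀ s ∈ Icc a b, y s = w s := by
  intro s hs
  obtain ⟨z, hzs, hz⟩ := exists_solution_of_linear_growth hf hr hfr hs.2 (y s)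
  have hbs : b ∈ Icc s b := ⟨hs.2, le_rfl⟩
  have hbab : b ∈ Icc a b := ⟨hs.1.trans hs.2, le_rfl⟩
  have hws : ∀ t ∈ Icc s b, HasDerivAt w (f (w t)) t := fun t ht => hw t ⟨hs.1.trans ht.1, ht.2⟩
  have hwy : w s ≤ y s := hy.lower_le hf hF hw h0.ge s hs
  have hzb : z b = w b := by
    refine le_antisymm (hb ▸ (hy.mono hs hbab).lower_le hf hF hz hzs.le b hbs) ?_
    exact (acArc_of_hasDerivAt hf.continuous hs.2 hws).le_of_subsolution hf
      (acArc_of_hasDerivAt hf.continuous hs.2 hz) (Eventually.of_forall fun _ _ => le_rfl)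
      (Eventually.of_forall fun _ _ => le_rfl) (hwy.trans hzs.ge) b hbs
  have hzc := HasDerivAt.continuousOn hz
  have hwc := HasDerivAt.continuousOn hws
  obtain ⟨K, hK⟩ := hf.exists_lipschitzOnWith
    ((isCompact_Icc.image_of_continuousOn hzc).union (isCompact_Icc.image_of_continuousOn hwc))
  rw [← hzs]
  exact ODE_solution_unique_of_mem_Icc_left (v := fun _ => f) (fun _ _ => hK) hzc
    (fun t ht => (hz t (Ioc_subset_Icc_self ht)).hasDerivWithinAt)
    (fun t ht => Or.inl ⟨t, Ioc_subset_Icc_self ht, rfl⟩) hwc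
    (fun t ht => (hws t (Ioc_subset_Icc_self ht)).hasDerivWithinAt)
    (fun t ht => Or.inr ⟨t, Ioc_subset_Icc_self ht, rfl⟩) hzb ⟨le_rfl, hs.2⟩

/-- Right continuity of the final value of a solution with respect to the initial value. -/
lemma exists_solution_le_add (hf : LocallyLipschitz f) (hr : 0 ≤ r)
    (hfr : ∀ x, |f x| ≤ r * (1 + |x|)) (hab : a ≤ b) {w : ℝ → ℝ}
    (hw : ∀ s ∈ Icc a b, HasDerivAt w (f (w s)) s) {δ : ℝ} (hδ : 0 < δ) :
    ∃ η > 0, ∀ x₁ ∈ Ioo (w a) (w a + η), ∃ z : ℝ → ℝ, z a = x₁ ∧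
      (∀ s ∈ Icc a b, HasDerivAt z (f (z s)) s) ∧ z b ≤ w b + δ := by
  obtain ⟨u, hua, hu⟩ := exists_solution_of_linear_growth hf hr hfr hab (w a + 1)
  have hwc := HasDerivAt.continuousOn hw
  have harc : ∀ {z : ℝ → ℝ}, (∀ s ∈ Icc a b, HasDerivAt z (f (z s)) s) →
      ACArc a b z (fun s => f (z s)) := acArc_of_hasDerivAt hf.continuous hab
  have hcomp : ∀ {z₁ z₂ : ℝ → ℝ}, (∀ s ∈ Icc a b, HasDerivAt z₁ (f (z₁ s)) s) →
      (∀ s ∈ Icc a b, HasDerivAt z₂ (f (z₂ s)) s) → z₁ a ≤ z₂ a →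
      ∀ s ∈ Icc a b, z₁ s ≤ z₂ s := fun h₁ h₂ =>
    (harc h₁).le_of_subsolution hf (harc h₂) (Eventually.of_forall fun _ _ => le_rfl)
      (Eventually.of_forall fun _ _ => le_rfl)
  obtain ⟨m, hm⟩ := isCompact_Icc.bddBelow_image hwc
  obtain ⟨M, hM⟩ := isCompact_Icc.bddAbove_image (HasDerivAt.continuousOn hu)
  obtain ⟨K, hK⟩ := hf.exists_lipschitzOnWith (isCompact_Icc (a := m) (b := M))
  refine ⟨min 1 (δ * Real.exp (-(K * (b - a)))), by positivity, fun x₁ hx₁ => ?_⟩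
  obtain ⟨z, hza, hz⟩ := exists_solution_of_linear_growth hf hr hfr hab x₁
  refine ⟨z, hza, hz, ?_⟩
  have hx₁' : x₁ < w a + 1 := hx₁.2.trans_le (by gcongr; exact min_le_left _ _)
  have hx₁'' : x₁ - w a ≤ δ * Real.exp (-(K * (b - a))) := by
    have := hx₁.2
    linarith [min_le_right 1 (δ * Real.exp (-(K * (b - a))))]
  have hwz := hcomp hw hz (hza ▸ hx₁.1.le)
  have hzu := hcomp hz hu (by rw [hza, hua]; exact hx₁'.le)
  have hwu := hcomp hw hu (by rw [hua]; linarith)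
  have hmem : ∀ {v : ℝ → ℝ}, (∀ s ∈ Icc a b, w s ≤ v s) → (∀ s ∈ Icc a b, v s ≤ u s) →
      ∀ s ∈ Ico a b, v s ∈ Icc m M := fun h₁ h₂ s hs =>
    have hs' := Ico_subset_Icc_self hs
    ⟨(hm ⟨s, hs', rfl⟩).trans (h₁ s hs'), (h₂ s hs').trans (hM ⟨s, hs', rfl⟩)⟩
  have hdist := dist_le_of_trajectories_ODE_of_mem (v := fun _ => f) (fun _ _ => hK)
    (HasDerivAt.continuousOn hz)
    (fun s hs => (hz s (Ico_subset_Icc_self hs)).hasDerivWithinAt) (hmem hwz hzu) hwc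
    (fun s hs => (hw s (Ico_subset_Icc_self hs)).hasDerivWithinAt)
    (hmem (fun _ _ => le_rfl) hwu) le_rfl b ⟨hab, le_rfl⟩
  rw [Real.dist_eq, Real.dist_eq, hza, abs_of_pos (sub_pos.2 hx₁.1)] at hdist
  have : (x₁ - w a) * Real.exp (K * (b - a)) ≤ δ := by
    calc (x₁ - w a) * Real.exp (K * (b - a))
        ≤ δ * Real.exp (-(K * (b - a))) * Real.exp (K * (b - a)) := by gcongr
      _ = δ := by rw [mul_assoc, ← Real.exp_add]; simp
  linarith [le_abs_self (z b - w b)]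

lemma bddBelow_final_cost (hf : LocallyLipschitz f) (hg : LocallyLipschitz g) (hr : 0 ≤ r)
    (hfr : ∀ x, |f x| ≤ r * (1 + |x|)) (hgr : ∀ x, |g x| ≤ r * (1 + |x|))
    (hF : ∀ x, F x = Icc (f x) (g x)) (hφ : Continuous φ) (hab : a ≤ b) (x₀ : ℝ) :
    BddBelow {c | ∃ y y' : ℝ → ℝ, IsTraj F a b y y' ∧ y a = x₀ ∧ c = φ (y b)} := by
  obtain ⟨w, hwa, hw⟩ := exists_solution_of_linear_growth hf hr hfr hab x₀
  obtain ⟨z, hza, hz⟩ := exists_solution_of_linear_growth hg hr hgr hab x₀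
  refine ((isCompact_Icc (a := w b) (b := z b)).bddBelow_image hφ.continuousOn).mono ?_
  rintro _ ⟨y, y', hy, hya, rfl⟩
  have hb : b ∈ Icc a b := ⟨hab, le_rfl⟩
  exact ⟨y b, ⟨hy.lower_le hf (fun x => by rw [hF]; exact Icc_subset_Ici_self) hw
    (hwa.trans hya.symm).le b hb, hy.le_upper hg (fun x => by rw [hF]; exact Icc_subset_Iic_self) hz
    (hya.trans hza.symm).le b hb⟩, rfl⟩

/-- If a lower solution started above `y a` ends below `y b`, then the endpoint of `y` is
reachable from the starting point of the lower solution. -/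
lemma IsTraj.exists_isTraj_of_crossing (hy : IsTraj F a b y y') (hf : Continuous f)
    (hfF : ∀ x, f x ∈ F x) (hab : a ≤ b) {w : ℝ → ℝ}
    (hw : ∀ s ∈ Icc a b, HasDerivAt w (f (w s)) s) (ha : y a ≤ w a) (hb : w b ≤ y b) :
    ∃ z z' : ℝ → ℝ, IsTraj F a b z z' ∧ z a = w a ∧ z b = y b := by
  have hc := (hy.1.continuousOn hab).sub (HasDerivAt.continuousOn hw)
  obtain ⟨c, hc, hcy⟩ := intermediate_value_Icc hab hc
    (show (0:ℝ) ∈ Icc (y a - w a) (y b - w b) from ⟨sub_nonpos.2 ha, sub_nonneg.2 hb⟩)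
  have hcy' : w c = y c := (sub_eq_zero.1 hcy).symm
  refine ⟨_, _, ((isTraj_of_selection hf hfF hab hw).mono ⟨le_rfl, hab⟩ hc).concat
    (hy.mono hc ⟨hab, le_rfl⟩) hc.1 hc.2 hcy', if_pos hc.1, ?_⟩
  split_ifs with h
  · rw [le_antisymm h hc.2, hcy']
  · rfl

/-- If the value function increases at `x₀`, then trajectories whose endpoint stays away from that
of the lower solution are not nearly optimal. -/
lemma exists_gap_of_hasDerivAt_pos (hf : LocallyLipschitz f) (hg : LocallyLipschitz g)
    (hr : 0 ≤ r) (hfr : ∀ x, |f x| ≤ r * (1 + |x|)) (hgr : ∀ x, |g x| ≤ r * (1 + |x|))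
    (hF : ∀ x, F x = Icc (f x) (g x)) (hfg : ∀ x, f x ≤ g x) (hφ : Continuous φ) (hab : a ≤ b)
    {w : ℝ → ℝ} (hw : ∀ s ∈ Icc a b, HasDerivAt w (f (w s)) s) {p : ℝ} (hp : 0 < p)
    (hV : HasDerivAt (fun x => valueFn F φ b a x) p (w a)) {δ : ℝ} (hδ : 0 < δ) :
    ∃ ε > 0, ∀ y y' : ℝ → ℝ, IsTraj F a b y y' → y a = w a → w b + δ ≤ y b →
      valueFn F φ b a (w a) + ε ≤ φ (y b) := by
  by_contra! hcon
  have hfF : ∀ x, f x ∈ F x := fun x => by rw [hF]; exact left_mem_Icc.2 (hfg x)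
  obtain ⟨η, hη, hsol⟩ := exists_solution_le_add hf hr hfr hab hw hδ
  have hle : ∀ x₁ ∈ Ioo (w a) (w a + η), valueFn F φ b a x₁ ≤ valueFn F φ b a (w a) := by
    intro x₁ hx₁
    obtain ⟨u, hua, hu, hub⟩ := hsol x₁ hx₁
    refine le_of_forall_pos_le_add fun ε hε => ?_
    obtain ⟨y, y', hy, hya, hyb, hlt⟩ := hcon ε hε
    obtain ⟨z, z', hz, hza, hzb⟩ := hy.exists_isTraj_of_crossing hf.continuous hfF hab hu
      (by rw [hya, hua]; exact hx₁.1.le) (hub.trans hyb)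
    refine le_trans ?_ hlt.le
    exact csInf_le (bddBelow_final_cost hf hg hr hfr hgr hF hφ hab x₁)
      ⟨z, z', hz, hza.trans hua, by rw [hzb]⟩
  have hslope := (hasDerivWithinAt_iff_tendsto_slope' (s := Ioi (w a)) (by simp)).1
    hV.hasDerivWithinAt
  obtain ⟨x₁, hx₁, hx₁'⟩ := ((hslope.eventually (lt_mem_nhds hp)).and
    (Ioo_mem_nhdsGT (lt_add_of_pos_right (w a) hη))).exists
  rw [slope_def_field] at hx₁
  exact hx₁.not_ge (div_nonpos_of_nonpos_of_nonneg (sub_nonpos.2 (hle x₁ hx₁'))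
    (sub_nonneg.2 hx₁'.1.le))

/-- Where the value function increases, the solution of `x' = f(x)` is the unique optimal
trajectory. -/
lemma exists_unique_optimal_of_hasDerivAt_pos (hf : LocallyLipschitz f) (hg : LocallyLipschitz g)
    (hr : 0 ≤ r) (hfr : ∀ x, |f x| ≤ r * (1 + |x|)) (hgr : ∀ x, |g x| ≤ r * (1 + |x|))
    (hF : ∀ x, F x = Icc (f x) (g x)) (hfg : ∀ x, f x ≤ g x) (hφ : Continuous φ) (hab : a ≤ b)
    {p : ℝ} (hp : 0 < p) (hV : HasDerivAt (fun x => valueFn F φ b a x) p x₀) :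
    ∃ x : ℝ → ℝ, (∀ s ∈ Icc a b, HasDerivAt x (f (x s)) s) ∧ x a = x₀ ∧
      IsOptimal F φ a b x₀ x (fun s => f (x s)) ∧
      ∀ y y' : ℝ → ℝ, IsOptimal F φ a b x₀ y y' → ∀ s ∈ Icc a b, y s = x s := by
  obtain ⟨w, rfl, hw⟩ := exists_solution_of_linear_growth hf hr hfr hab x₀
  have hfF : ∀ x, f x ∈ F x := fun x => by rw [hF]; exact left_mem_Icc.2 (hfg x)
  have hFf : ∀ x, F x ⊆ Ici (f x) := fun x => by rw [hF]; exact Icc_subset_Ici_self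
  have hwT := isTraj_of_selection hf.continuous hfF hab hw
  have hb : b ∈ Icc a b := ⟨hab, le_rfl⟩
  have hVle : ∀ y y' : ℝ → ℝ, IsTraj F a b y y' → y a = w a →
      valueFn F φ b a (w a) ≤ φ (y b) := fun y y' hy hya =>
    csInf_le (bddBelow_final_cost hf hg hr hfr hgr hF hφ hab _) ⟨y, y', hy, hya, rfl⟩
  have hwV : φ (w b) ≤ valueFn F φ b a (w a) := by
    refine le_of_forall_pos_le_add fun ε hε => ?_
    obtain ⟨δ, hδ, hδφ⟩ := Metric.continuousAt_iff.1 hφ.continuousAt (ε / 2) (half_pos hε)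
    obtain ⟨ε', hε', hgap⟩ :=
      exists_gap_of_hasDerivAt_pos hf hg hr hfr hgr hF hfg hφ hab hw hp hV hδ
    obtain ⟨_, ⟨y, y', hy, hya, rfl⟩, hlt⟩ := exists_lt_of_csInf_lt
      (s := {c | ∃ y y' : ℝ → ℝ, IsTraj F a b y y' ∧ y a = w a ∧ c = φ (y b)})
      ⟨_, w, _, hwT, rfl, rfl⟩
      (show sInf _ < valueFn F φ b a (w a) + min (ε / 2) ε' from
        lt_add_of_pos_right _ (lt_min (half_pos hε) hε'))
    have h1 : y b < w b + δ := by
      by_contra! h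
      have := hgap y y' hy hya h
      linarith [min_le_right (ε / 2) ε']
    have h2 := hy.lower_le hf hFf hw hya.ge b hb
    have h3 := hδφ (x := y b) (by rw [Real.dist_eq, abs_lt]; constructor <;> linarith)
    rw [Real.dist_eq, abs_lt] at h3
    linarith [min_le_left (ε / 2) ε', h3.1]
  refine ⟨w, hw, rfl, ⟨hwT, rfl, fun y y' hy hya => hwV.trans (hVle y y' hy hya)⟩,
    fun y y' hy => ?_⟩
  refine hy.1.eq_lower hf hr hfr hFf hw hy.2.1
    (le_antisymm ?_ (hy.1.lower_le hf hFf hw hy.2.1.ge b hb))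
  refine le_of_forall_pos_le_add fun δ hδ => ?_
  obtain ⟨ε, hε, hgap⟩ := exists_gap_of_hasDerivAt_pos hf hg hr hfr hgr hF hfg hφ hab hw hp hV hδ
  by_contra! h
  have h1 := hgap y y' hy.1 hy.2.1 h.le
  have h2 := hy.2.2 w _ hwT rfl
  linarith

end Interval

section Reflection

variable {F : E → Set E} {φ : E → ℝ} {a b : ℝ} {x₀ : E} {y y' : ℝ → E}

omit [CompleteSpace E] in
lemma IsTraj.neg (h : IsTraj F a b y y') : IsTraj (fun x => -F (-x)) a b (-y) (-y') := by
  refine ⟨h.1.neg, ?_⟩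
  filter_upwards [h.2] with s hs hsab
  simpa using hs hsab

omit [CompleteSpace E] in
lemma valueFn_neg :
    valueFn (fun x => -F (-x)) (fun x => φ (-x)) b a (-x₀) = valueFn F φ b a x₀ := by
  unfold valueFn
  congr 1
  ext c
  constructor
  · rintro ⟨y, y', hy, hya, rfl⟩
    exact ⟨-y, -y', by simpa using hy.neg, by simp [hya], rfl⟩
  · rintro ⟨y, y', hy, hya, rfl⟩
    exact ⟨-y, -y', hy.neg, by simp [hya], by simp⟩

omit [CompleteSpace E] in
lemma IsOptimal.neg (h : IsOptimal F φ a b x₀ y y') :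
    IsOptimal (fun x => -F (-x)) (fun x => φ (-x)) a b (-x₀) (-y) (-y') := by
  refine ⟨h.1.neg, by simp [h.2.1], fun z z' hz hza => ?_⟩
  simpa using h.2.2 (-z) (-z') (by simpa using hz.neg) (by simp [hza])

end Reflection

/-- The endpoints of a Hausdorff-Lipschitz interval-valued map are locally Lipschitz. -/
lemma locallyLipschitz_endpoints {f g : ℝ → ℝ} {F : ℝ → Set ℝ}
    (hF : ∀ x, F x = Icc (f x) (g x)) (hfg : ∀ x, f x ≤ g x) (hSH : StandingHyp F) :
    LocallyLipschitz f ∧ LocallyLipschitz g := by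
  have key : ∀ x : ℝ, ∃ ε > (0:ℝ), ∃ c : ℝ, 0 ≤ c ∧ ∀ y ∈ ball x ε, ∀ z ∈ ball x ε,
      ∀ u ∈ F y, ∃ v ∈ F z, |u - v| ≤ c * |y - z| := by
    intro x
    obtain ⟨ε, hε, c, hc, h⟩ := hSH.2.1 x
    refine ⟨ε, hε, c, hc, fun y hy z hz u hu => ?_⟩
    have hcp := (hSH.1 z).2.2
    obtain ⟨v, hv, hvd⟩ := hcp.exists_infDist_eq_dist (hSH.1 z).1 u
    refine ⟨v, hv, ?_⟩
    have h1 : infEDist u (F z) ≤ ENNReal.ofReal (c * dist y z) :=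
      (infEDist_le_hausdorffEDist_of_mem hu).trans (h y hy z hz)
    have h2 := ENNReal.toReal_le_of_le_ofReal (by positivity) h1
    rw [← Real.dist_eq, ← Real.dist_eq, ← hvd]
    exact h2
  constructor <;> intro x <;> obtain ⟨ε, hε, c, hc, h⟩ := key x <;>
    refine ⟨NNReal.mk c hc, ball x ε, ball_mem_nhds x hε, LipschitzOnWith.of_le_add_mul _ ?_⟩ <;>
    intro y hy z hz <;> rw [Real.dist_eq, NNReal.coe_mk]
  · obtain ⟨v, hv, hvd⟩ := h z hz y hy (f z) (by rw [hF]; exact left_mem_Icc.2 (hfg z))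
    rw [hF] at hv
    rw [abs_sub_comm y z]
    linarith [hv.1, neg_abs_le (f z - v)]
  · obtain ⟨v, hv, hvd⟩ := h y hy z hz (g y) (by rw [hF]; exact right_mem_Icc.2 (hfg y))
    rw [hF] at hv
    linarith [hv.2, le_abs_self (g y - v)]

/-- the one-dimensional example.
Let `n = 1`, `F(x) = [f(x),g(x)]` with `f ≤ g`, `−f` and `g` locally semiconvex (so that
(SH) and (H1) hold). If `V` is differentiable at `(t₀,x₀)` with `V_x(t₀,x₀) ≠ 0`, then
there is a unique optimal trajectory for `P(t₀,x₀)`, namely the unique solution of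
`x' = f(x)` if `V_x(t₀,x₀) > 0` and of `x' = g(x)` if `V_x(t₀,x₀) < 0`, with
`x(t₀) = x₀`. -/
theorem stmt19 (f g : ℝ → ℝ) (F : ℝ → Set ℝ) (hF : ∀ x, F x = Icc (f x) (g x))
    (hfg : ∀ x, f x ≤ g x)
    (hfscv : LocSemiconvex (fun x => -f x)) (hgscv : LocSemiconvex g)
    (hSH : StandingHyp F) (hH1 : HypH1 F)
    (φ : ℝ → ℝ) (hφ : LocallyLipschitz φ) (T t0 x0 : ℝ) (ht : t0 ∈ Ico (0:ℝ) T)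
    (hdiff : DifferentiableAt ℝ (fun q : ℝ × ℝ => valueFn F φ T q.1 q.2) (t0, x0))
    (hVx : deriv (fun y => valueFn F φ T t0 y) x0 ≠ 0) :
    ∃ x : ℝ → ℝ,
      (∀ s ∈ Icc t0 T, HasDerivAt x
        ((if 0 < deriv (fun y => valueFn F φ T t0 y) x0 then f else g) (x s)) s) ∧
      x t0 = x0 ∧
      IsOptimal F φ t0 T x0 x
        (fun s => (if 0 < deriv (fun y => valueFn F φ T t0 y) x0 then f else g) (x s)) ∧
      (∀ y y' : ℝ → ℝ, IsOptimal F φ t0 T x0 y y' → ∀ s ∈ Icc t0 T, y s = x s) := by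
  obtain ⟨hf, hg⟩ := locallyLipschitz_endpoints hF hfg hSH
  obtain ⟨r, hr, hgrow⟩ := hSH.2.2
  have hfr : ∀ x, |f x| ≤ r * (1 + |x|) := fun x =>
    hgrow x _ (by rw [hF]; exact left_mem_Icc.2 (hfg x))
  have hgr : ∀ x, |g x| ≤ r * (1 + |x|) := fun x =>
    hgrow x _ (by rw [hF]; exact right_mem_Icc.2 (hfg x))
  have hV := (differentiableAt_of_deriv_ne_zero hVx).hasDerivAt
  split_ifs with hpos
  · exact exists_unique_optimal_of_hasDerivAt_pos hf hg hr.le hfr hgr hF hfg hφ.continuous ht.2.le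
      hpos hV
  · have hneg : 0 < -deriv (fun y => valueFn F φ T t0 y) x0 :=
      neg_pos.2 (lt_of_le_of_ne (not_lt.1 hpos) hVx)
    have hrefl : ∀ {h : ℝ → ℝ}, LocallyLipschitz h → LocallyLipschitz (fun x => -h (-x)) :=
      fun hh => (LipschitzWith.id.neg.locallyLipschitz.comp
        (hh.comp LipschitzWith.id.neg.locallyLipschitz) :)
    have hV' : HasDerivAt (fun x => valueFn (fun x => -F (-x)) (fun x => φ (-x)) T t0 x)
        (-deriv (fun y => valueFn F φ T t0 y) x0) (-x0) := by
      have h := HasDerivAt.comp (-x0) (by rwa [neg_neg]) (hasDerivAt_neg (-x0))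
      rw [mul_neg_one] at h
      refine h.congr_of_eventuallyEq (Eventually.of_forall fun x => ?_)
      simpa using valueFn_neg (F := F) (φ := φ) (a := t0) (b := T) (x₀ := -x)
    obtain ⟨x, hx, hx0, hopt, huniq⟩ := exists_unique_optimal_of_hasDerivAt_pos (hrefl hg) (hrefl hf)
      hr.le (fun x => by simpa using hgr (-x)) (fun x => by simpa using hfr (-x))
      (fun x => by rw [hF, neg_Icc]) (fun x => neg_le_neg (hfg (-x)))
      (hφ.continuous.comp continuous_neg) ht.2.le hneg hV'
    refine ⟨-x, fun s hs => by simpa using (hx s hs).neg, by simp [hx0], ?_, fun y y' hy s hs => ?_⟩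
    · convert hopt.neg using 1 <;> funext <;> simp
    · have := huniq (-y) (-y') hy.neg s hs
      simp [← this]

end
end
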